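/- arXiv:1609.03693 — 6 statements merged into one kernel-verified Lean document; each statement's English description precedes it below -/
import Mathlib

section
/- Let X be a Banach space, α ∈ (0,1), and let w ∈ C^α([0,T];X) with w(0) = 0. If β ∈ (0, α), then the function t ↦ (1/Γ(1−β)) ∫_0^t (t−τ)^{−β} w(τ) dτ is differentiable on [0,T], the Riemann–Liouville fractional derivative D^β w belongs to C^{α−β}([0,T];X), and (D^β w)(0) = 0. -/
open Set MeasureTheory

/-- Membership in the Hölder space `C^α([0,T];X)`:
there is a constant `C` with `‖w t - w s‖ ≤ C |t-s|^α` on `[0,T]`. -/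
def MemHolderB {X : Type*} [NormedAddCommGroup X] (α T : ℝ) (w : ℝ → X) : Prop :=
  ∃ C : ℝ, ∀ s ∈ Icc (0:ℝ) T, ∀ t ∈ Icc (0:ℝ) T, ‖w t - w s‖ ≤ C * |t - s| ^ α

/-- The Riemann–Liouville fractional derivative of order `β` of `w : [0,T] → X`:
`D^β w (t) = (d/dt) (1/Γ(1-β)) ∫_0^t (t-τ)^(-β) w(τ) dτ`
(derivative within `[0,T]`, i.e. one-sided at the endpoints). -/
noncomputable def RLDB (β T : ℝ) {X : Type*} [NormedAddCommGroup X] [NormedSpace ℝ X]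
    (w : ℝ → X) (t : ℝ) : X :=
  derivWithin (fun s => (Real.Gamma (1 - β))⁻¹ • ∫ τ in (0:ℝ)..s, ((s - τ) ^ (-β)) • w τ)
    (Icc 0 T) t


open Filter Topology in
lemma aux_min (α β h : ℝ) (hα : β < α) (hβ : 0 < β) (hh : 0 < h) :
    IntegrableOn (fun r : ℝ => r ^ (-β - 1) * (min r h) ^ α) (Ioi 0) ∧
    ∫ r in Ioi (0:ℝ), r ^ (-β - 1) * (min r h) ^ α = ((α - β)⁻¹ + β⁻¹) * h ^ (α - β) := by
  have e1 : EqOn (fun r : ℝ => r ^ (-β - 1) * (min r h) ^ α) (fun r => r ^ (α - β - 1))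
      (Ioc 0 h) := by
    intro r hr
    simp only
    rw [min_eq_left hr.2, ← Real.rpow_add hr.1]
    congr 1; ring
  have e2 : EqOn (fun r : ℝ => r ^ (-β - 1) * (min r h) ^ α) (fun r => r ^ (-β - 1) * h ^ α)
      (Ioi h) := by
    intro r hr
    simp only
    rw [min_eq_right (le_of_lt hr)]
  have i1 : IntegrableOn (fun r : ℝ => r ^ (α - β - 1)) (Ioc 0 h) :=
    (intervalIntegrable_iff_integrableOn_Ioc_of_le hh.le).1
      (intervalIntegral.intervalIntegrable_rpow' (by linarith))
  have i2 : IntegrableOn (fun r : ℝ => r ^ (-β - 1) * h ^ α) (Ioi h) :=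
    (integrableOn_Ioi_rpow_of_lt (by linarith) hh).mul_const _
  have j1 := i1.congr_fun e1.symm measurableSet_Ioc
  have j2 := i2.congr_fun e2.symm measurableSet_Ioi
  refine ⟨?_, ?_⟩
  · rw [← Ioc_union_Ioi_eq_Ioi hh.le]
    exact j1.union j2
  · rw [← Ioc_union_Ioi_eq_Ioi hh.le, setIntegral_union (Ioc_disjoint_Ioi le_rfl)
      measurableSet_Ioi j1 j2, setIntegral_congr_fun measurableSet_Ioc e1,
      setIntegral_congr_fun measurableSet_Ioi e2, integral_mul_const,
      integral_Ioi_rpow_of_lt (by linarith) hh, ← intervalIntegral.integral_of_le hh.le,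
      integral_rpow (Or.inl (by linarith))]
    have e3 : α - β - 1 + 1 = α - β := by ring
    have e4 : -β - 1 + 1 = -β := by ring
    have e5 : h ^ (α - β) = h ^ (-β) * h ^ α := by
      rw [← Real.rpow_add hh]; congr 1; ring
    rw [e3, e4, Real.zero_rpow (by linarith), e5]
    have : α - β ≠ 0 := by linarith
    field_simp
    ring

section core
variable {X : Type*} [NormedAddCommGroup X] [NormedSpace ℝ X] [CompleteSpace X]

lemma aux_cont (C α : ℝ) (hα : 0 < α) (v : ℝ → X)
    (hv : ∀ s t, ‖v t - v s‖ ≤ C * |t - s| ^ α) : Continuous v := by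
  rw [continuous_iff_continuousAt]
  intro s
  rw [ContinuousAt, tendsto_iff_norm_sub_tendsto_zero]
  refine squeeze_zero (fun t => norm_nonneg _) (fun t => hv s t) ?_
  have : Continuous (fun t : ℝ => C * |t - s| ^ α) := by
    refine continuous_const.mul (Continuous.rpow_const (by fun_prop) (fun _ => Or.inr hα.le))
  have h := this.tendsto s
  simpa [Real.zero_rpow hα.ne'] using h

noncomputable def auxG (β : ℝ) (v : ℝ → X) (t : ℝ) : X :=
  ∫ r in Ioi (0:ℝ), r ^ (-β - 1) • (v t - v (t - r))

lemma aux_bd (C α T : ℝ) (hα : 0 < α) (hT : 0 < T) (v : ℝ → X)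
    (hv : ∀ s t, ‖v t - v s‖ ≤ C * |t - s| ^ α) (hb : ∀ s t, ‖v t - v s‖ ≤ C * T ^ α)
    (β t r : ℝ) (hr : 0 < r) :
    ‖r ^ (-β - 1) • (v t - v (t - r))‖ ≤ C * (r ^ (-β - 1) * (min r T) ^ α) := by
  rw [norm_smul, Real.norm_of_nonneg (Real.rpow_nonneg hr.le _), mul_left_comm]
  refine mul_le_mul_of_nonneg_left ?_ (Real.rpow_nonneg hr.le _)
  rcases le_total r T with h | h
  · rw [min_eq_left h]
    have := hv (t - r) t
    rwa [sub_sub_cancel, abs_of_pos hr] at this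
  · rw [min_eq_right h]; exact hb _ _

lemma aux_int (C α β T : ℝ) (hβ : 0 < β) (hαβ : β < α) (hT : 0 < T) (v : ℝ → X)
    (hv : ∀ s t, ‖v t - v s‖ ≤ C * |t - s| ^ α) (hb : ∀ s t, ‖v t - v s‖ ≤ C * T ^ α) (t : ℝ) :
    IntegrableOn (fun r : ℝ => r ^ (-β - 1) • (v t - v (t - r))) (Ioi 0) := by
  have hc := aux_cont C α (hβ.trans hαβ) v hv
  refine Integrable.mono' ((aux_min α β T hαβ hβ hT).1.const_mul C) ?_ ?_
  · refine AEStronglyMeasurable.smul ?_ ?_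
    · exact (Measurable.pow_const measurable_id _).aestronglyMeasurable
    · exact (by fun_prop : Continuous fun r => v t - v (t - r)).aestronglyMeasurable
  · filter_upwards [ae_restrict_mem measurableSet_Ioi] with r hr
    exact aux_bd C α T (hβ.trans hαβ) hT v hv hb β t r hr

lemma aux_holder (C α β T : ℝ) (hβ : 0 < β) (hαβ : β < α) (hT : 0 < T)
    (v : ℝ → X)
    (hv : ∀ s t, ‖v t - v s‖ ≤ C * |t - s| ^ α) (hb : ∀ s t, ‖v t - v s‖ ≤ C * T ^ α) (s t : ℝ) :
    ‖auxG β v t - auxG β v s‖ ≤ (2 * C * ((α - β)⁻¹ + β⁻¹)) * |t - s| ^ (α - β) := by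
  rcases eq_or_ne t s with rfl | hts
  · simp [Real.zero_rpow (sub_pos.2 hαβ).ne']
  have hh : 0 < |t - s| := abs_pos.2 (sub_ne_zero.2 hts)
  have hm := aux_min α β _ hαβ hβ hh
  rw [auxG, auxG, ← integral_sub (aux_int C α β T hβ hαβ hT v hv hb t)
    (aux_int C α β T hβ hαβ hT v hv hb s)]
  refine (norm_integral_le_of_norm_le (hm.1.const_mul (2 * C)) ?_).trans ?_
  · filter_upwards [ae_restrict_mem measurableSet_Ioi] with r hr
    have hr : 0 < r := hr
    rw [← smul_sub, norm_smul, Real.norm_of_nonneg (Real.rpow_nonneg hr.le _), mul_left_comm]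
    refine mul_le_mul_of_nonneg_left ?_ (Real.rpow_nonneg hr.le _)
    rcases le_total r |t - s| with h | h
    · rw [min_eq_left h]
      have h1 := hv (t - r) t
      have h2 := hv (s - r) s
      rw [sub_sub_cancel, abs_of_pos hr] at h1 h2
      have := norm_sub_le (v t - v (t - r)) (v s - v (s - r))
      linarith
    · rw [min_eq_right h]
      have h1 := hv s t
      have h2 := hv (s - r) (t - r)
      rw [sub_sub_sub_cancel_right] at h2
      have := norm_sub_le (v t - v s) (v (t - r) - v (s - r))
      rw [sub_sub_sub_comm] at this
      linarith
  · rw [integral_const_mul, hm.2]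
    exact le_of_eq (by ring)

open Filter Topology in
lemma aux_ftc (C α β T : ℝ) (hβ : 0 < β) (hαβ : β < α) (hα1 : α < 1) (hT : 0 < T) (v : ℝ → X)
    (hv : ∀ s t, ‖v t - v s‖ ≤ C * |t - s| ^ α) (hb : ∀ s t, ‖v t - v s‖ ≤ C * T ^ α)
    (h0 : ∀ t ≤ 0, v t = 0) (t : ℝ) (ht : 0 ≤ t) :
    ∫ τ in (0:ℝ)..t, (t - τ) ^ (-β) • v τ = β • ∫ s in (0:ℝ)..t, auxG β v s := by
  have hα : 0 < α := hβ.trans hαβ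
  have hc := aux_cont C α hα v hv
  set W : ℝ → X := fun x => ∫ s in (0:ℝ)..x, v s with hW
  have hW0 : ∀ x ≤ 0, W x = 0 := by
    intro x hx
    simp only [hW]
    rw [intervalIntegral.integral_congr (g := fun _ => (0 : X))]
    · simp
    · intro s hs
      rw [uIcc_of_ge hx] at hs
      exact h0 s hs.2
  have hWd : ∀ x, HasDerivAt W (v x) x := fun x => (hc.integral_hasStrictDerivAt 0 x).hasDerivAt
  have hWs : ∀ a b, W b - W a = ∫ s in a..b, v s := fun a b =>
    intervalIntegral.integral_interval_sub_left (hc.intervalIntegrable _ _)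
      (hc.intervalIntegrable _ _)
  have hvM : ∀ x, ‖v x‖ ≤ C * T ^ α := by
    intro x
    have := hb 0 x
    rwa [h0 0 le_rfl, sub_zero] at this
  -- Fubini
  have hF : Integrable (Function.uncurry fun (s r : ℝ) => r ^ (-β - 1) • (v s - v (s - r)))
      ((volume.restrict (Ioc 0 t)).prod (volume.restrict (Ioi 0))) := by
    refine Integrable.mono' (((aux_min α β T hαβ hβ hT).1.const_mul C).comp_snd
      (volume.restrict (Ioc 0 t))) ?_ ?_
    · refine AEStronglyMeasurable.smul ?_ ?_
      · exact (Measurable.pow_const measurable_snd _).aestronglyMeasurable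
      · exact (by fun_prop : Continuous fun p : ℝ × ℝ => v p.1 - v (p.1 - p.2)).aestronglyMeasurable
    · rw [Measure.prod_restrict]
      filter_upwards [ae_restrict_mem (measurableSet_Ioc.prod measurableSet_Ioi)] with p hp
      exact aux_bd C α T hα hT v hv hb β p.1 p.2 hp.2
  have hin : ∀ r : ℝ, ∫ s in Ioc 0 t, r ^ (-β - 1) • (v s - v (s - r)) = 
      r ^ (-β - 1) • (W t - W (t - r) + W (-r)) := by
    intro r
    rw [integral_smul, ← intervalIntegral.integral_of_le ht, intervalIntegral.integral_sub
      (hc.intervalIntegrable _ _) ((by fun_prop : Continuous fun s => v (s - r)).intervalIntegrable _ _),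
      intervalIntegral.integral_comp_sub_right, ← hWs, ← hWs, zero_sub, hW0 0 le_rfl]
    congr 1
    abel
  have hin' : EqOn (fun r : ℝ => ∫ s in Ioc 0 t, r ^ (-β - 1) • (v s - v (s - r)))
      (fun r => r ^ (-β - 1) • (W t - W (t - r))) (Ioi 0) := by
    intro r hr
    simp only
    rw [hin, hW0 (-r) (by have : 0 < r := hr; linarith), add_zero]
  have hG : ∫ s in (0:ℝ)..t, auxG β v s = ∫ r in Ioi (0:ℝ), r ^ (-β - 1) • (W t - W (t - r)) := by
    rw [intervalIntegral.integral_of_le ht]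
    unfold auxG
    rw [integral_integral_swap hF]
    exact setIntegral_congr_fun measurableSet_Ioi hin'
  have hI1 : IntegrableOn (fun r : ℝ => r ^ (-β - 1) • (W t - W (t - r))) (Ioi 0) :=
    IntegrableOn.congr_fun hF.integral_prod_right hin' measurableSet_Ioi
  have hI1s : IntegrableOn (fun r : ℝ => β • (r ^ (-β - 1) • (W t - W (t - r)))) (Ioi 0) :=
    hI1.smul β
  have hz : ∀ r ∈ Ioi (0:ℝ) \ Ioc 0 t, r ^ (-β) • v (t - r) = 0 := by
    intro r hr
    have h1 : 0 < r := hr.1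
    have : t < r := by
      by_contra hcon
      exact hr.2 ⟨h1, not_lt.1 hcon⟩
    rw [h0 (t - r) (by linarith), smul_zero]
  have hI2 : IntegrableOn (fun r : ℝ => r ^ (-β) • v (t - r)) (Ioi 0) := by
    have : IntegrableOn (fun r : ℝ => r ^ (-β) • v (t - r)) (Ioc 0 t) := by
      refine (intervalIntegrable_iff_integrableOn_Ioc_of_le ht).1 ?_
      refine (intervalIntegral.intervalIntegrable_rpow' (by linarith)).smul_continuousOn ?_
      exact (by fun_prop : Continuous fun r => v (t - r)).continuousOn
    exact this.of_forall_sdiff_eq_zero measurableSet_Ioi hz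
  have hL : ∫ τ in (0:ℝ)..t, (t - τ) ^ (-β) • v τ = ∫ r in Ioi (0:ℝ), r ^ (-β) • v (t - r) := by
    rw [setIntegral_eq_of_subset_of_forall_sdiff_eq_zero measurableSet_Ioi Ioc_subset_Ioi_self hz,
      ← intervalIntegral.integral_of_le ht]
    have := intervalIntegral.integral_comp_sub_left (a := 0) (b := t)
      (fun τ => (t - τ) ^ (-β) • v τ) t
    simpa using this.symm
  have key : ∫ r in Ioi (0:ℝ), (β • (r ^ (-β - 1) • (W t - W (t - r))) - r ^ (-β) • v (t - r))
      = 0 - (fun r : ℝ => (-(r ^ (-β))) • (W t - W (t - r))) 0 := by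
    have hI3 : IntegrableOn (fun r : ℝ => β • (r ^ (-β - 1) • (W t - W (t - r)))
        - r ^ (-β) • v (t - r)) (Ioi 0) := hI1s.sub hI2
    refine integral_Ioi_of_hasDerivAt_of_tendsto (m := (0 : X))
      (f := fun r : ℝ => (-(r ^ (-β))) • (W t - W (t - r))) ?_ ?_ hI3 ?_
    · rw [ContinuousWithinAt]
      simp only [sub_zero, sub_self, smul_zero]
      refine squeeze_zero_norm' (a := fun r => C * T ^ α * r ^ (1 - β)) ?_ ?_
      · filter_upwards [self_mem_nhdsWithin] with r hr
        have hr : 0 ≤ r := hr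
        rcases hr.eq_or_lt with rfl | hr
        · simp [Real.zero_rpow (by linarith : 1 - β ≠ 0)]
        rw [norm_smul, norm_neg, Real.norm_of_nonneg (Real.rpow_nonneg hr.le _), hWs]
        have h1 : ‖∫ s in (t - r)..t, v s‖ ≤ C * T ^ α * |t - (t - r)| :=
          intervalIntegral.norm_integral_le_of_norm_le_const (fun x _ => hvM x)
        rw [sub_sub_cancel, abs_of_pos hr] at h1
        calc _ ≤ r ^ (-β) * (C * T ^ α * r) :=
              mul_le_mul_of_nonneg_left h1 (Real.rpow_nonneg hr.le _)
          _ = C * T ^ α * (r ^ (-β) * r ^ (1:ℝ)) := by rw [Real.rpow_one]; ring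
          _ = _ := by
              rw [← Real.rpow_add hr]; congr 2; ring
      · have : Continuous (fun r : ℝ => C * T ^ α * r ^ (1 - β)) :=
          continuous_const.mul (Real.continuous_rpow_const (by linarith))
        have h := (this.tendsto 0).mono_left (nhdsWithin_le_nhds (s := Ici 0))
        simpa [Real.zero_rpow (by linarith : 1 - β ≠ 0)] using h
    · intro r hr
      have hr : 0 < r := hr
      have d1 : HasDerivAt (fun r : ℝ => -(r ^ (-β))) (-(-β * r ^ (-β - 1))) r :=
        (Real.hasDerivAt_rpow_const (Or.inl hr.ne')).neg
      have d2 : HasDerivAt (fun r : ℝ => W t - W (t - r)) (v (t - r)) r := by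
        have := ((hWd (t - r)).scomp r ((hasDerivAt_id r).const_sub t)).const_sub (W t)
        simpa [Function.comp_def] using this
      convert d1.smul d2 using 1
      · rfl
      rw [smul_smul]
      simp only [neg_mul, neg_neg, neg_smul]
      abel
    · have h1 : Tendsto (fun r : ℝ => (-(r ^ (-β))) • W t) atTop (𝓝 0) := by
        have := (tendsto_rpow_neg_atTop hβ).neg.smul_const (W t)
        simpa using this
      refine h1.congr' ?_
      filter_upwards [eventually_ge_atTop t] with r hr
      rw [hW0 (t - r) (by linarith), sub_zero]
  rw [integral_sub hI1s hI2, integral_smul] at key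
  simp only [sub_zero, sub_self, smul_zero] at key
  rw [hL, hG]
  exact (sub_eq_zero.1 key).symm

end core

/-- If `w ∈ C^α([0,T];X)` with `w(0) = 0` and `β ∈ (0, α)`, then
`t ↦ (1/Γ(1-β)) ∫_0^t (t-τ)^(-β) w(τ) dτ` is differentiable on `[0,T]`,
`D^β w ∈ C^{α-β}([0,T];X)` and `(D^β w)(0) = 0`. -/
theorem frac_derivative_holder
    {X : Type*} [NormedAddCommGroup X] [NormedSpace ℝ X] [CompleteSpace X]
    (T α β : ℝ) (hT : 0 < T) (hα : α ∈ Ioo (0:ℝ) 1) (hβ : β ∈ Ioo (0:ℝ) α)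
    (w : ℝ → X) (hw : MemHolderB α T w) (hw0 : w 0 = 0) :
    (∀ t ∈ Icc (0:ℝ) T, DifferentiableWithinAt ℝ
        (fun s => (Real.Gamma (1 - β))⁻¹ • ∫ τ in (0:ℝ)..s, ((s - τ) ^ (-β)) • w τ)
        (Icc 0 T) t) ∧
    MemHolderB (α - β) T (RLDB β T w) ∧ RLDB β T w 0 = 0 := by
  obtain ⟨C₀, hC₀⟩ := hw
  obtain ⟨hα0, hα1⟩ := hα
  obtain ⟨hβ0, hβα⟩ := hβ
  obtain ⟨C, hC0, hC⟩ : ∃ C : ℝ, 0 ≤ C ∧ ∀ s ∈ Icc (0:ℝ) T, ∀ t ∈ Icc (0:ℝ) T,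
      ‖w t - w s‖ ≤ C * |t - s| ^ α :=
    ⟨|C₀|, abs_nonneg _, fun s hs t ht => (hC₀ s hs t ht).trans
      (mul_le_mul_of_nonneg_right (le_abs_self _) (Real.rpow_nonneg (abs_nonneg _) _))⟩
  set p : ℝ → ℝ := fun x => max 0 (min x T) with hp
  have hpm : ∀ x, p x ∈ Icc (0:ℝ) T := fun x =>
    ⟨le_max_left _ _, max_le hT.le (min_le_right _ _)⟩
  have hpe : ∀ x ∈ Icc (0:ℝ) T, p x = x := by
    intro x hx
    simp only [hp]
    rw [min_eq_left hx.2, max_eq_right hx.1]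
  have hpl : ∀ x y, |p x - p y| ≤ |x - y| := by
    intro x y
    simp only [hp]
    refine (abs_max_sub_max_le_max _ _ _ _).trans ?_
    refine max_le (by simp) ((abs_min_sub_min_le_max _ _ _ _).trans (by simp))
  set v : ℝ → X := fun x => w (p x) with hvdef
  have hv : ∀ s t, ‖v t - v s‖ ≤ C * |t - s| ^ α := fun s t =>
    (hC _ (hpm s) _ (hpm t)).trans (mul_le_mul_of_nonneg_left
      (Real.rpow_le_rpow (abs_nonneg _) (hpl t s) hα0.le) hC0)
  have hb : ∀ s t, ‖v t - v s‖ ≤ C * T ^ α := fun s t =>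
    (hC _ (hpm s) _ (hpm t)).trans (mul_le_mul_of_nonneg_left
      (Real.rpow_le_rpow (abs_nonneg _) (by
        have h1 := hpm s
        have h2 := hpm t
        rw [abs_le]; constructor <;> linarith [h1.1, h1.2, h2.1, h2.2]) hα0.le) hC0)
  have h0 : ∀ t ≤ 0, v t = 0 := by
    intro t ht
    have : p t = 0 := max_eq_left ((min_le_left _ _).trans ht)
    simp only [hvdef, this, hw0]
  have hH := aux_holder C α β T hβ0 hβα hT v hv hb
  have hGc : Continuous (auxG β v) := aux_cont _ (α - β) (sub_pos.2 hβα) _ hH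
  have hEq : EqOn (fun s => (Real.Gamma (1 - β))⁻¹ • ∫ τ in (0:ℝ)..s, ((s - τ) ^ (-β)) • w τ)
      (fun s => (Real.Gamma (1 - β))⁻¹ • β • ∫ x in (0:ℝ)..s, auxG β v x) (Icc 0 T) := by
    intro s hs
    simp only
    rw [← aux_ftc C α β T hβ0 hβα hα1 hT v hv hb h0 s hs.1]
    congr 1
    refine intervalIntegral.integral_congr ?_
    intro τ hτ
    rw [uIcc_of_le hs.1] at hτ
    simp only [hvdef]
    rw [hpe τ ⟨hτ.1, hτ.2.trans hs.2⟩]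
  have hD : ∀ t ∈ Icc (0:ℝ) T, HasDerivWithinAt
      (fun s => (Real.Gamma (1 - β))⁻¹ • ∫ τ in (0:ℝ)..s, ((s - τ) ^ (-β)) • w τ)
      ((Real.Gamma (1 - β))⁻¹ • β • auxG β v t) (Icc 0 T) t := by
    intro t ht
    refine HasDerivWithinAt.congr ?_ hEq (hEq ht)
    exact (((hGc.integral_hasStrictDerivAt 0 t).hasDerivAt.const_smul β).const_smul
      (Real.Gamma (1 - β))⁻¹).hasDerivWithinAt
  have hR : ∀ t ∈ Icc (0:ℝ) T, RLDB β T w t = (Real.Gamma (1 - β))⁻¹ • β • auxG β v t :=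
    fun t ht => (hD t ht).derivWithin (uniqueDiffOn_Icc hT t ht)
  refine ⟨fun t ht => (hD t ht).differentiableWithinAt, ?_, ?_⟩
  · refine ⟨‖(Real.Gamma (1 - β))⁻¹‖ * (‖β‖ * (2 * C * ((α - β)⁻¹ + β⁻¹))), ?_⟩
    intro s hs t ht
    rw [hR s hs, hR t ht, ← smul_sub, ← smul_sub, norm_smul, norm_smul, mul_assoc, mul_assoc]
    gcongr
    exact hH s t
  · rw [hR 0 ⟨le_rfl, hT.le⟩]
    have : auxG β v 0 = 0 := by
      unfold auxG
      rw [setIntegral_congr_fun (g := fun _ => (0 : X)) measurableSet_Ioi]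
      · simp
      · intro r hr
        have hr : 0 < r := hr
        simp only
        rw [h0 0 le_rfl, h0 (0 - r) (by linarith), sub_self, smul_zero]
    rw [this, smul_zero, smul_zero]
end

section
/- (Positivity principle) Let Ω ⊂ ℝ^n be a bounded open domain with smooth boundary ∂Ω, let A be the elliptic operator below with a_{ij}, a_j ∈ C(Ω̄), and let k ∈ L¹(0,T) ∩ C(0,T] be positive and decreasing on (0,T] with k(t) → ∞ as t → 0⁺. Let f ∈ C(ℝ×[0,T]×Ω̄) satisfy: there exist M ≥ 0 and η > 0 with f(w,t,x) ≥ −M|w| for all w ∈ (−η,0), t ∈ [0,T], x ∈ Ω̄. Let u ∈ C([0,T]×Ω̄) with u_{x_j}, u_{x_i x_j} ∈ C((0,T]×Ω̄) and D^{{k}}[u(·,x) − u_0(x)] ∈ C((0,T]×Ω̄) solve D^{{k}}[u(t,x) − u_0(x)] = A(x)u(t,x) + f(u(t,x),t,x) for t ∈ (0,T), x ∈ Ω, with u(0,x) = u_0(x) on Ω and the Dirichlet boundary condition u = g on (0,T)×∂Ω, and assume condition (as4). If u_0 ≥ 0 and g ≥ 0, then u ≥ 0 on [0,T]×Ω̄.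 -/
open Set MeasureTheory Filter Topology

/-- The convolution `t ↦ ∫_0^t k(t-τ) w(τ) dτ`. -/
noncomputable def kConv (k w : ℝ → ℝ) (t : ℝ) : ℝ := ∫ τ in (0:ℝ)..t, k (t - τ) * w τ

/-- The generalized fractional derivative `D^{{k}} w = (d/dt) ∫_0^t k(t-τ) w(τ) dτ`
(derivative within `[0,T]`, i.e. one-sided at the endpoints). -/
noncomputable def Dk (k : ℝ → ℝ) (T : ℝ) (w : ℝ → ℝ) (t : ℝ) : ℝ :=
  derivWithin (kConv k w) (Icc 0 T) t

/-- The kernel assumptions: `k ∈ L¹(0,T) ∩ C(0,T]`, `k > 0`, `k` decreasing. -/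
def KernelOK (k : ℝ → ℝ) (T : ℝ) : Prop :=
  IntegrableOn k (Ioc 0 T) ∧ ContinuousOn k (Ioc 0 T) ∧ (∀ t ∈ Ioc 0 T, 0 < k t) ∧
    ∀ s ∈ Ioc (0:ℝ) T, ∀ t ∈ Ioc (0:ℝ) T, s ≤ t → k t ≤ k s

/-- Partial derivative `∂v/∂x_i`. -/
noncomputable def pd {n : ℕ} (i : Fin n) (v : (Fin n → ℝ) → ℝ) (x : Fin n → ℝ) : ℝ :=
  fderiv ℝ v x (Pi.single i 1)

/-- The second order operator
`A(x)v = Σ_{i,j} a_{ij}(x) ∂²v/∂x_i∂x_j + Σ_j a_j(x) ∂v/∂x_j`. -/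
noncomputable def ellOp {n : ℕ} (aC : Fin n → Fin n → (Fin n → ℝ) → ℝ)
    (bC : Fin n → (Fin n → ℝ) → ℝ) (v : (Fin n → ℝ) → ℝ) (x : Fin n → ℝ) : ℝ :=
  (∑ i, ∑ j, aC i j x * pd i (pd j v) x) + ∑ j, bC j x * pd j v x

/-- Uniform ellipticity: `Σ_{i,j} a_{ij}(x) ξ_i ξ_j ≥ c |ξ|²` on `Ω`. -/
def IsElliptic {n : ℕ} (aC : Fin n → Fin n → (Fin n → ℝ) → ℝ) (Ω : Set (Fin n → ℝ)) : Prop :=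
  ∃ c > 0, ∀ x ∈ Ω, ∀ ξ : Fin n → ℝ, c * ∑ i, ξ i ^ 2 ≤ ∑ i, ∑ j, aC i j x * ξ i * ξ j

/-- Condition (as4): for every `t ∈ (0,T]`, `x ∈ Ω̄`,
`(1/ε) ∫_0^ε k(τ)dτ · sup_{0≤s≤ε} |u(t-s,x) - u(t,x)| → 0` as `ε → 0⁺`. -/
def As4 {n : ℕ} (k : ℝ → ℝ) (T : ℝ) (Ω : Set (Fin n → ℝ)) (u : ℝ → (Fin n → ℝ) → ℝ) : Prop :=
  ∀ t ∈ Ioc (0:ℝ) T, ∀ x ∈ closure Ω,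
    Tendsto (fun ε => ε⁻¹ * (∫ τ in (0:ℝ)..ε, k τ) *
        sSup ((fun s => |u (t - s) x - u t x|) '' Icc 0 ε)) (𝓝[>] 0) (𝓝 0)


theorem aux_int_s3 {k w : ℝ → ℝ} {T : ℝ} (hk : KernelOK k T)
    {t h μ ε S : ℝ} (htT : t ≤ T)
    (hw : ContinuousOn (fun s => w (t - s)) (Icc 0 t))
    (hε : 0 < ε) (hεh : ε < h) (hht : h ≤ t) (hμ : 0 ≤ μ)
    (h1 : ∀ s ∈ Icc 0 t, w t ≤ w (t - s))
    (h2 : ∀ s ∈ Icc h t, w t + μ ≤ w (t - s))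
    (h3 : w t + μ ≤ 0)
    (hS : ∀ s ∈ Icc 0 ε, w (t - s) - w t ≤ S) :
    kConv k w t - kConv k w (t - ε) ≤ (∫ s in (0:ℝ)..ε, k s) * S - μ * (ε * k h) := by
  obtain ⟨hki, hkc, hkp, hkd⟩ := hk
  have hkI : ∀ a b, 0 ≤ a → a ≤ b → b ≤ T → IntervalIntegrable k volume a b := by
    intro a b ha hab hb
    rw [intervalIntegrable_iff_integrableOn_Ioc_of_le hab]
    exact hki.mono_set (Ioc_subset_Ioc ha hb)
  have hkI' : ∀ a b, ε ≤ a → a ≤ b → b ≤ T → 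
      IntervalIntegrable (fun s => k (s - ε)) volume a b := by
    intro a b ha hab hb
    have := (hkI (a - ε) (b - ε) (by linarith) (by linarith) (by linarith)).comp_sub_right ε
    simpa using this
  have hwI : ∀ (q : ℝ → ℝ) a b, 0 ≤ a → a ≤ b → b ≤ t → IntervalIntegrable q volume a b → 
      IntervalIntegrable (fun s => q s * w (t - s)) volume a b := by
    intro q a b ha hab hb hq
    apply hq.mul_continuousOn
    rw [uIcc_of_le hab]
    exact hw.mono (Icc_subset_Icc ha hb)
  have e1 : kConv k w t = (∫ s in (0:ℝ)..ε, k s * w (t - s)) + ∫ s in ε..t, k s * w (t - s) := by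
    rw [intervalIntegral.integral_add_adjacent_intervals]
    · have := intervalIntegral.integral_comp_sub_left (a := 0) (b := t) 
        (fun s => k s * w (t - s)) t
      simp only [sub_sub_cancel, sub_self, sub_zero] at this
      exact this
    · exact hwI k _ _ le_rfl hε.le (by linarith) (hkI _ _ le_rfl hε.le (by linarith))
    · exact hwI k _ _ hε.le (by linarith) le_rfl (hkI _ _ hε.le (by linarith) htT)
  have e2 : kConv k w (t - ε) = ∫ s in ε..t, k (s - ε) * w (t - s) := by
    have := intervalIntegral.integral_comp_sub_left (a := 0) (b := t - ε) 
        (fun s => k (s - ε) * w (t - s)) t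
    simp only [sub_sub_cancel, sub_zero] at this
    rw [← this]
    unfold kConv
    congr 1
    ext τ
    congr 2
    ring
  have e3 : (∫ s in ε..t, k (s - ε) * w (t - s)) - (∫ s in ε..t, k s * w (t - s))
      = ∫ s in ε..t, (k (s - ε) - k s) * w (t - s) := by
    rw [← intervalIntegral.integral_sub]
    · congr 1; ext s; ring
    · exact hwI (fun s => k (s - ε)) _ _ hε.le (by linarith) le_rfl (hkI' _ _ le_rfl (by linarith) htT)
    · exact hwI k _ _ hε.le (by linarith) le_rfl (hkI _ _ hε.le (by linarith) htT)
  have hdI : ∀ a b, ε ≤ a → a ≤ b → b ≤ t → 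
      IntervalIntegrable (fun s => k (s - ε) - k s) volume a b := fun a b ha hab hb =>
    (hkI' a b ha hab (by linarith)).sub (hkI a b (by linarith) hab (by linarith))
  have hd0 : ∀ s ∈ Ioo ε t, 0 ≤ k (s - ε) - k s := by
    intro s hs
    have := hkd (s - ε) ⟨by linarith [hs.1], by linarith [hs.2]⟩ s ⟨by linarith [hs.1], by linarith [hs.2]⟩ (by linarith)
    linarith
  have e4 : ∀ a, ε ≤ a → a ≤ t → (∫ s in a..t, (k (s - ε) - k s)) = 
      (∫ s in (a-ε)..a, k s) - ∫ s in (t-ε)..t, k s := by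
    intro a ha hat
    rw [intervalIntegral.integral_sub (hkI' _ _ ha hat htT) (hkI _ _ (by linarith) hat htT),
      intervalIntegral.integral_comp_sub_right k ε]
    have i1 := intervalIntegral.integral_add_adjacent_intervals 
      (hkI (a-ε) a (by linarith) (by linarith) (by linarith)) (hkI a t (by linarith) hat htT)
    have i2 := intervalIntegral.integral_add_adjacent_intervals 
      (hkI (a-ε) (t-ε) (by linarith) (by linarith) (by linarith)) (hkI (t-ε) t (by linarith) (by linarith) htT)
    linarith
  have e5 : (∫ s in ε..h, (k (s - ε) - k s) * w t) ≤ ∫ s in ε..h, (k (s - ε) - k s) * w (t - s) := by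
    apply intervalIntegral.integral_mono_on_of_le_Ioo hεh.le
    · exact (hdI _ _ le_rfl hεh.le hht).mul_const _
    · exact hwI (fun s => k (s - ε) - k s) _ _ hε.le hεh.le hht (hdI _ _ le_rfl hεh.le hht)
    · intro s hs
      exact mul_le_mul_of_nonneg_left (h1 s ⟨by linarith [hs.1], by linarith [hs.2]⟩) 
        (hd0 s ⟨hs.1, by linarith [hs.2]⟩)
  have e6 : (∫ s in h..t, (k (s - ε) - k s) * (w t + μ)) ≤ ∫ s in h..t, (k (s - ε) - k s) * w (t - s) := by
    apply intervalIntegral.integral_mono_on_of_le_Ioo hht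
    · exact (hdI _ _ hεh.le hht le_rfl).mul_const _
    · exact hwI (fun s => k (s - ε) - k s) _ _ (by linarith) hht le_rfl (hdI _ _ hεh.le hht le_rfl)
    · intro s hs
      exact mul_le_mul_of_nonneg_left (h2 s ⟨by linarith [hs.1], by linarith [hs.2]⟩) 
        (hd0 s ⟨by linarith [hs.1], by linarith [hs.2]⟩)
  have e7 := intervalIntegral.integral_add_adjacent_intervals 
    (hwI (fun s => k (s - ε) - k s) _ _ hε.le hεh.le hht (hdI _ _ le_rfl hεh.le hht))
    (hwI (fun s => k (s - ε) - k s) _ _ (by linarith) hht le_rfl (hdI _ _ hεh.le hht le_rfl))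
  have e8 := intervalIntegral.integral_add_adjacent_intervals 
    (hdI _ _ le_rfl hεh.le hht) (hdI _ _ hεh.le hht le_rfl)
  rw [e4 ε le_rfl (by linarith), sub_self, e4 h hεh.le hht] at e8
  rw [intervalIntegral.integral_mul_const] at e5 e6
  rw [e4 h hεh.le hht] at e6
  have e9 : (∫ s in (0:ℝ)..ε, k s * w (t - s)) ≤ ∫ s in (0:ℝ)..ε, k s * (w t + S) := by
    apply intervalIntegral.integral_mono_on_of_le_Ioo hε.le
    · exact hwI k _ _ le_rfl hε.le (by linarith) (hkI _ _ le_rfl hε.le (by linarith))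
    · exact (hkI _ _ le_rfl hε.le (by linarith)).mul_const _
    · intro s hs
      have := hS s ⟨hs.1.le, hs.2.le⟩
      exact mul_le_mul_of_nonneg_left (by linarith) (hkp s ⟨hs.1, by linarith [hs.2]⟩).le
  rw [intervalIntegral.integral_mul_const] at e9
  have e10 : ε * k h ≤ ∫ s in (h-ε)..h, k s := by
    have : (∫ s in (h-ε)..h, k h) ≤ ∫ s in (h-ε)..h, k s := by
      apply intervalIntegral.integral_mono_on_of_le_Ioo (by linarith)
      · simp
      · exact hkI _ _ (by linarith) (by linarith) (by linarith)
      · intro s hs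
        exact hkd s ⟨by linarith [hs.1], by linarith [hs.2]⟩ h ⟨by linarith, by linarith⟩ hs.2.le
    simpa using this
  have e11 : 0 ≤ ∫ s in (t-ε)..t, k s := by
    apply intervalIntegral.integral_nonneg (by linarith)
    intro s hs
    exact (hkp s ⟨by linarith [hs.1], by linarith [hs.2]⟩).le
  have e12 := mul_le_mul_of_nonneg_left e10 hμ
  have e13 := mul_nonneg_of_nonpos_of_nonpos h3 (neg_nonpos.2 e11)
  have e14 : (∫ s in ε..h, (k (s - ε) - k s)) = (∫ s in (0:ℝ)..ε, k s) - (∫ s in (h-ε)..h, k s) := by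
    linarith
  rw [e14] at e5
  rw [e1, e2]
  nlinarith

theorem aux_time {k w : ℝ → ℝ} {T : ℝ} (hk : KernelOK k T)
    {t h μ : ℝ} (htT : t ≤ T)
    (hw : ContinuousOn w (Icc 0 T))
    (hh : 0 < h) (hht : h ≤ t) (hμ : 0 ≤ μ)
    (h1 : ∀ s ∈ Icc 0 t, w t ≤ w (t - s))
    (h2 : ∀ s ∈ Icc h t, w t + μ ≤ w (t - s))
    (h3 : w t + μ ≤ 0)
    (h4 : Tendsto (fun ε => ε⁻¹ * (∫ τ in (0:ℝ)..ε, k τ) *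
        sSup ((fun s => |w (t - s) - w t|) '' Icc 0 ε)) (𝓝[>] 0) (𝓝 0))
    (h5 : DifferentiableWithinAt ℝ (kConv k w) (Icc 0 T) t) :
    Dk k T w t ≤ -(μ * k h) := by
  have hw' : ContinuousOn (fun s => w (t - s)) (Icc 0 t) := by
    apply hw.comp (by fun_prop)
    intro s hs
    exact ⟨by linarith [hs.2], by linarith [hs.1]⟩
  have hD := h5.hasDerivWithinAt
  rw [hasDerivWithinAt_iff_tendsto_slope] at hD
  have hc : Tendsto (fun ε : ℝ => t - ε) (𝓝[>] 0) (𝓝[Icc 0 T \ {t}] t) := by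
    apply tendsto_nhdsWithin_of_tendsto_nhds_of_eventually_within
    · apply tendsto_nhdsWithin_of_tendsto_nhds
      have : Continuous (fun ε : ℝ => t - ε) := by fun_prop
      simpa using this.tendsto 0
    · filter_upwards [Ioo_mem_nhdsGT hh] with ε hε
      refine ⟨⟨by linarith [hε.2], by linarith [hε.1]⟩, ?_⟩
      simp [hε.1.ne']
  have hD' := hD.comp hc
  have hR := h4.sub_const (μ * k h)
  rw [zero_sub] at hR
  refine le_of_tendsto_of_tendsto hD' hR ?_
  filter_upwards [Ioo_mem_nhdsGT hh] with ε hε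
  have hb : BddAbove ((fun s => |w (t - s) - w t|) '' Icc 0 ε) := by
    apply IsCompact.bddAbove_image isCompact_Icc
    exact ((hw'.mono (Icc_subset_Icc le_rfl (by linarith [hε.2]))).sub continuousOn_const).abs
  have := aux_int_s3 hk htT hw' hε.1 hε.2 hht hμ h1 h2 h3 
    (S := sSup ((fun s => |w (t - s) - w t|) '' Icc 0 ε))
    (fun s hs => (le_abs_self _).trans (le_csSup hb ⟨s, hs, rfl⟩))
  simp only [Function.comp, slope_def_field]
  have e : (kConv k w (t - ε) - kConv k w t) / (t - ε - t) = ε⁻¹ * (kConv k w t - kConv k w (t - ε)) := by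
    have := hε.1.ne'
    rw [show t - ε - t = -ε by ring]
    field_simp
    ring
  rw [e]
  have h6 := mul_le_mul_of_nonneg_left this (inv_nonneg.2 hε.1.le)
  refine h6.trans (le_of_eq ?_)
  have := hε.1.ne'
  field_simp

theorem aux_trace {n : ℕ} (a H : Fin n → Fin n → ℝ)
    (ha : ∀ ξ : Fin n → ℝ, 0 ≤ ∑ i, ∑ j, a i j * ξ i * ξ j)
    (hsymm : ∀ i j, H i j = H j i)
    (hH : ∀ ξ : Fin n → ℝ, 0 ≤ ∑ i, ∑ j, ξ i * ξ j * H i j) :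
    0 ≤ ∑ i, ∑ j, a i j * H i j := by
  have hP : (Matrix.of H).PosSemidef := by
    apply Matrix.PosSemidef.of_dotProduct_mulVec_nonneg
    · ext i j
      simp [hsymm i j]
    · intro ξ
      refine (hH ξ).trans (le_of_eq ?_)
      simp only [dotProduct, Matrix.mulVec, Finset.mul_sum, Matrix.of_apply, Pi.star_apply, star_trivial]
      refine Finset.sum_congr rfl fun i _ => Finset.sum_congr rfl fun j _ => ?_
      ring
  obtain ⟨m, v, hv⟩ := Matrix.posSemidef_iff_eq_sum_vecMulVec.1 hP
  have hv' : ∀ i j, H i j = ∑ l, v l i * v l j := by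
    intro i j
    have := congrFun (congrFun hv i) j
    simpa [Matrix.sum_apply, Matrix.vecMulVec_apply] using this
  have : ∑ i, ∑ j, a i j * H i j = ∑ l, ∑ i, ∑ j, a i j * v l i * v l j := by
    rw [Finset.sum_comm]
    simp only [hv', Finset.mul_sum]
    rw [Finset.sum_comm]
    conv_lhs => enter [2, i]; rw [Finset.sum_comm]
    rw [Finset.sum_comm]
    exact Finset.sum_congr rfl fun l _ => Finset.sum_congr rfl fun i _ => 
      Finset.sum_congr rfl fun j _ => by ring
  rw [this]
  exact Finset.sum_nonneg fun l _ => ha (v l)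

theorem aux_fderiv {n : ℕ} (v : (Fin n → ℝ) → ℝ) (y ξ : Fin n → ℝ) :
    fderiv ℝ v y ξ = ∑ j, ξ j * pd j v y := by
  have : ξ = ∑ j, ξ j • (Pi.single j 1 : Fin n → ℝ) := by
    ext i
    simp [Finset.sum_apply, Pi.single_apply]
  conv_lhs => rw [this]
  simp [pd]

theorem aux_1d (φ : ℝ → ℝ) (hmin : IsLocalMin φ 0) (hc : ContinuousAt φ 0) :
    0 ≤ deriv (deriv φ) 0 := by
  by_contra! hneg
  have hmax := isLocalMax_of_deriv_deriv_neg hneg hmin.deriv_eq_zero hc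
  have h : φ =ᶠ[𝓝 0] fun _ => φ 0 := by
    filter_upwards [hmin, hmax] with s h1 h2
    exact le_antisymm h2 h1
  have := h.deriv.deriv_eq
  simp at this
  linarith

theorem aux_space {n : ℕ} (Ω : Set (Fin n → ℝ)) (hΩo : IsOpen Ω) (v : (Fin n → ℝ) → ℝ)
    (hd : ∀ x ∈ Ω, DifferentiableAt ℝ v x ∧ ∀ j, DifferentiableAt ℝ (pd j v) x)
    (x : Fin n → ℝ) (hx : x ∈ Ω) (hmin : IsLocalMin v x)
    (aC : Fin n → Fin n → (Fin n → ℝ) → ℝ) (bC : Fin n → (Fin n → ℝ) → ℝ)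
    (hell : IsElliptic aC Ω) : 0 ≤ ellOp aC bC v x := by
  have hf0 : ∀ j, pd j v x = 0 := by
    intro j
    simp [pd, hmin.fderiv_eq_zero]
  unfold ellOp
  simp only [hf0, mul_zero, Finset.sum_const_zero, add_zero]
  obtain ⟨c, hc, hcell⟩ := hell
  have hev : ∀ᶠ y in 𝓝 x, y ∈ Ω := hΩo.mem_nhds hx
  refine aux_trace (fun i j => aC i j x) (fun i j => pd i (pd j v) x) ?_ ?_ ?_
  · intro ξ
    exact le_trans (mul_nonneg hc.le (Finset.sum_nonneg fun i _ => sq_nonneg _)) (hcell x hx ξ)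
  · intro i j
    have hrep : fderiv ℝ v = fun y => ∑ l, (pd l v y) • (ContinuousLinearMap.proj l : (Fin n → ℝ) →L[ℝ] ℝ) := by
      ext1 y
      ext ξ
      rw [aux_fderiv]
      simp [mul_comm]
    have hdd : DifferentiableAt ℝ (fderiv ℝ v) x := by
      rw [hrep]
      have := (hd x hx).2
      fun_prop
    have hs := second_derivative_symmetric_of_eventually (f := v) (f' := fderiv ℝ v) (x := x)
      (hev.mono fun y hy => (hd y hy).1.hasFDerivAt) hdd.hasFDerivAt
    have hpd : ∀ i j, pd i (pd j v) x = fderiv ℝ (fderiv ℝ v) x (Pi.single i 1) (Pi.single j 1) := by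
      intro i j
      have : HasFDerivAt (pd j v) _ x := hdd.hasFDerivAt.clm_apply (hasFDerivAt_const (Pi.single j (1:ℝ) : Fin n → ℝ) x)
      rw [pd, this.fderiv]
      simp
    change pd i (pd j v) x = pd j (pd i v) x
    rw [hpd, hpd, hs]
  · intro ξ
    have hline : ∀ s : ℝ, HasDerivAt (fun s : ℝ => x + s • ξ) ξ s := by
      intro s
      simpa using ((hasDerivAt_id s).smul_const ξ).const_add x
    have hcont : Tendsto (fun s : ℝ => x + s • ξ) (𝓝 0) (𝓝 x) := by
      simpa using (hline 0).continuousAt.tendsto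
    have hmin' : IsLocalMin (fun s : ℝ => v (x + s • ξ)) 0 := by
      have := hcont.eventually hmin
      simpa [IsLocalMin, IsMinFilter] using this
    have hder : deriv (fun s : ℝ => v (x + s • ξ)) =ᶠ[𝓝 0] fun s => ∑ j, ξ j * pd j v (x + s • ξ) := by
      filter_upwards [hcont.eventually hev] with s hs
      rw [← aux_fderiv]
      exact ((hd _ hs).1.hasFDerivAt.comp_hasDerivAt s (hline s)).deriv
    have hx0 : x + (0:ℝ) • ξ = x := by simp
    have h0 := aux_1d _ hmin' (by
      have : ContinuousAt v (x + (0:ℝ) • ξ) := by rw [hx0]; exact (hd x hx).1.continuousAt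
      exact this.comp (f := fun s : ℝ => x + s • ξ) (hline 0).continuousAt)
    rw [hder.deriv_eq] at h0
    have hD : HasDerivAt (fun s : ℝ => ∑ j, ξ j * pd j v (x + s • ξ)) 
        (∑ j, ξ j * (∑ i, ξ i * pd i (pd j v) x)) 0 := by
      apply HasDerivAt.fun_sum
      intro j _
      apply HasDerivAt.const_mul
      rw [← aux_fderiv]
      have : HasFDerivAt (pd j v) (fderiv ℝ (pd j v) x) (x + (0:ℝ) • ξ) := by
        rw [hx0]; exact ((hd x hx).2 j).hasFDerivAt
      exact this.comp_hasDerivAt 0 (hline 0)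
    rw [hD.deriv] at h0
    rw [Finset.sum_comm]
    refine h0.trans (le_of_eq ?_)
    simp only [Finset.mul_sum]
    exact Finset.sum_congr rfl fun i _ => Finset.sum_congr rfl fun j _ => by ring

/-- **Positivity principle (Theorem 2(i), Dirichlet case).**  If `u₀ ≥ 0` and `g ≥ 0`
then `u ≥ 0` on `[0,T] × Ω̄`. -/
theorem positivity_principle {n : ℕ}
    (T : ℝ) (hT : 0 < T)
    (Ω : Set (Fin n → ℝ)) (hΩo : IsOpen Ω) (hΩb : Bornology.IsBounded Ω)
    (aC : Fin n → Fin n → (Fin n → ℝ) → ℝ) (bC : Fin n → (Fin n → ℝ) → ℝ)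
    (haC : ∀ i j, ContinuousOn (aC i j) (closure Ω))
    (hbC : ∀ j, ContinuousOn (bC j) (closure Ω))
    (hell : IsElliptic aC Ω)
    (k : ℝ → ℝ) (hk : KernelOK k T)
    (hkinf : Tendsto k (𝓝[>] 0) atTop)
    (f : ℝ → ℝ → (Fin n → ℝ) → ℝ)
    (hf : ContinuousOn (fun p : ℝ × ℝ × (Fin n → ℝ) => f p.1 p.2.1 p.2.2)
      ((univ : Set ℝ) ×ˢ (Icc 0 T ×ˢ closure Ω)))
    (hflow : ∃ M ≥ (0:ℝ), ∃ η > (0:ℝ), ∀ w ∈ Ioo (-η) (0:ℝ), ∀ t ∈ Icc (0:ℝ) T,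
      ∀ x ∈ closure Ω, -M * |w| ≤ f w t x)
    (u : ℝ → (Fin n → ℝ) → ℝ) (u₀ : (Fin n → ℝ) → ℝ) (g : ℝ → (Fin n → ℝ) → ℝ)
    (hu : ContinuousOn (fun p : ℝ × (Fin n → ℝ) => u p.1 p.2) (Icc 0 T ×ˢ closure Ω))
    (hux : ∀ j, ContinuousOn (fun p : ℝ × (Fin n → ℝ) => pd j (u p.1) p.2)
      (Ioc 0 T ×ˢ closure Ω))
    (huxx : ∀ i j, ContinuousOn (fun p : ℝ × (Fin n → ℝ) => pd i (pd j (u p.1)) p.2)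
      (Ioc 0 T ×ˢ closure Ω))
    (hudiff : ∀ t ∈ Ioc (0:ℝ) T, ∀ x ∈ Ω,
      DifferentiableAt ℝ (u t) x ∧ ∀ j, DifferentiableAt ℝ (pd j (u t)) x)
    (hDkdiff : ∀ x ∈ closure Ω, ∀ t ∈ Ioc (0:ℝ) T,
      DifferentiableWithinAt ℝ (kConv k (fun τ => u τ x - u₀ x)) (Icc 0 T) t)
    (hDkcont : ContinuousOn
      (fun p : ℝ × (Fin n → ℝ) => Dk k T (fun τ => u τ p.2 - u₀ p.2) p.1)
      (Ioc 0 T ×ˢ closure Ω))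
    (heq : ∀ t ∈ Ioo (0:ℝ) T, ∀ x ∈ Ω,
      Dk k T (fun τ => u τ x - u₀ x) t = ellOp aC bC (u t) x + f (u t x) t x)
    (hinit : ∀ x ∈ closure Ω, u 0 x = u₀ x)
    (hbc : ∀ t ∈ Ioo (0:ℝ) T, ∀ x ∈ frontier Ω, u t x = g t x)
    (has4 : As4 k T Ω u)
    (hu₀ : ∀ x ∈ Ω, 0 ≤ u₀ x)
    (hg : ∀ t ∈ Ioo (0:ℝ) T, ∀ x ∈ frontier Ω, 0 ≤ g t x)
    :
    ∀ t ∈ Icc (0:ℝ) T, ∀ x ∈ closure Ω, 0 ≤ u t x := by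
  obtain ⟨M, hM, η, hη, hfl⟩ := hflow
  have hKc : IsCompact (closure Ω) := hΩb.isCompact_closure
  -- the initial value is nonnegative on the closure
  have hu0 : ∀ x ∈ closure Ω, 0 ≤ u 0 x := by
    have hc0 : ContinuousOn (u 0) (closure Ω) := by
      refine hu.comp (f := fun x => ((0:ℝ), x)) (by fun_prop) ?_
      intro x hx
      exact ⟨⟨le_rfl, hT.le⟩, hx⟩
    intro x hx
    have hmem : u 0 x ∈ closure (Ici (0:ℝ)) := by
      refine (hc0 x hx).mono subset_closure |>.mem_closure hx ?_
      intro y hy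
      have := hu₀ y hy
      rw [← hinit y (subset_closure hy)] at this
      exact this
    simpa using hmem
  have hut : ∀ x ∈ closure Ω, ContinuousOn (fun t => u t x) (Icc 0 T) := by
    intro x hx
    refine hu.comp (f := fun t => (t, x)) (by fun_prop) ?_
    intro t ht
    exact ⟨ht, hx⟩
  by_contra! hcon
  set S : Set ℝ := {t | t ∈ Icc 0 T ∧ ∃ x ∈ closure Ω, u t x < 0} with hSdef
  have hSne : S.Nonempty := by
    obtain ⟨t, ht, x, hx, hux⟩ := hcon
    exact ⟨t, ht, x, hx, hux⟩
  have hSb : BddBelow S := ⟨0, fun t ht => ht.1.1⟩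
  set r := sInf S with hr
  have hr0 : 0 ≤ r := le_csInf hSne fun t ht => ht.1.1
  have hrT : r ≤ T := by
    obtain ⟨t, ht⟩ := hSne
    exact (csInf_le hSb ht).trans ht.1.2
  have hlt : ∀ t, 0 ≤ t → t < r → ∀ x ∈ closure Ω, 0 ≤ u t x := by
    intro t ht htr x hx
    by_contra! hneg
    exact absurd (csInf_le hSb (show t ∈ S from ⟨⟨ht, by linarith⟩, x, hx, hneg⟩)) (not_le.2 htr)
  have hrr : ∀ x ∈ closure Ω, 0 ≤ u r x := by
    intro x hx
    rcases hr0.eq_or_lt with h0 | h0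
    · rw [← h0]; exact hu0 x hx
    · have hmem : u r x ∈ closure (Ici (0:ℝ)) := by
        have hcw : ContinuousWithinAt (fun t => u t x) (Ico 0 r) r :=
          (hut x hx r ⟨hr0, hrT⟩).mono fun t ht => ⟨ht.1, by linarith [ht.2]⟩
        refine hcw.mem_closure ?_ ?_
        · rw [closure_Ico h0.ne]; exact ⟨hr0, le_rfl⟩
        · intro t ht
          exact hlt t ht.1 ht.2 x hx
      simpa using hmem
  have hle : ∀ t, 0 ≤ t → t ≤ r → ∀ x ∈ closure Ω, 0 ≤ u t x := by
    intro t ht htr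
    rcases htr.eq_or_lt with h | h
    · rw [h]; exact hrr
    · exact hlt t ht h
  have hSr : ∀ t ∈ S, r < t := by
    intro t ht
    by_contra! h
    obtain ⟨ht1, x, hx, hneg⟩ := ht
    exact absurd (hle t ht1.1 h x hx) (not_le.2 hneg)
  have hrT' : r < T := by
    obtain ⟨t, ht⟩ := hSne
    exact (hSr t ht).trans_le ht.1.2
  -- uniform continuity
  have hunif := (isCompact_Icc.prod hKc).uniformContinuousOn_of_continuous hu
  rw [Metric.uniformContinuousOn_iff] at hunif
  obtain ⟨δ, hδ, hunif⟩ := hunif η hη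
  -- blow-up of the kernel
  obtain ⟨ρ, hρ, hkρ⟩ : ∃ ρ > (0:ℝ), ∀ s ∈ Ioo 0 ρ, M < k s := by
    have := hkinf.eventually (eventually_gt_atTop M)
    obtain ⟨ρ, hρ, h⟩ := mem_nhdsGT_iff_exists_Ioo_subset.1 this
    exact ⟨ρ, hρ, h⟩
  obtain ⟨τ, hτS, hτ⟩ : ∃ τ ∈ S, τ < min T (r + min δ ρ) := by
    apply exists_lt_of_csInf_lt hSne
    exact lt_min hrT' (by have := lt_min hδ hρ; linarith)
  have hτT : τ < T := hτ.trans_le (min_le_left _ _)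
  have hτδ : τ < r + δ := by
    have := hτ.trans_le (min_le_right _ _); have := min_le_left δ ρ; linarith
  have hτρ : τ < r + ρ := by
    have := hτ.trans_le (min_le_right _ _); have := min_le_right δ ρ; linarith
  have hτ0 : 0 ≤ τ := hτS.1.1
  obtain ⟨-, y, hy, hneg⟩ := hτS
  obtain ⟨⟨t, x⟩, ⟨ht, hx⟩, hmin⟩ := (isCompact_Icc.prod hKc).exists_isMinOn 
    ⟨(τ, y), ⟨⟨hτ0, le_rfl⟩, hy⟩⟩ (hu.mono (prod_mono (Icc_subset_Icc le_rfl hτT.le) subset_rfl))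
  have hmin' : ∀ s ∈ Icc 0 τ, ∀ z ∈ closure Ω, u t x ≤ u s z := by
    intro s hs z hz
    exact hmin (show (s, z) ∈ Icc 0 τ ×ˢ closure Ω from ⟨hs, hz⟩)
  simp only at ht hx
  have hun : u t x < 0 := (hmin' τ ⟨hτ0, le_rfl⟩ y hy).trans_lt hneg
  have htr : r < t := by
    by_contra! h
    exact absurd (hle t ht.1 h x hx) (not_le.2 hun)
  have ht0 : 0 < t := by linarith
  have htT : t < T := by linarith [ht.2]
  have hxΩ : x ∈ Ω := by
    by_contra h
    have hxf : x ∈ frontier Ω := ⟨hx, by rwa [hΩo.interior_eq]⟩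
    have h1 := hbc t ⟨ht0, htT⟩ x hxf
    have h2 := hg t ⟨ht0, htT⟩ x hxf
    linarith
  have hA : 0 ≤ ellOp aC bC (u t) x := by
    refine aux_space Ω hΩo (u t) (hudiff t ⟨ht0, htT.le⟩) x hxΩ ?_ aC bC hell
    filter_upwards [hΩo.mem_nhds hxΩ] with z hz
    exact hmin' t ht z (subset_closure hz)
  have hη' : -η < u t x := by
    have := hunif (t, x) ⟨⟨ht.1, htT.le⟩, hx⟩ (r, x) ⟨⟨hr0, hrT⟩, hx⟩ (by
      rw [Prod.dist_eq]
      simp only [dist_self, Real.dist_eq]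
      rw [abs_of_pos (by linarith)]
      exact max_lt (by linarith [ht.2]) hδ)
    rw [Real.dist_eq, abs_lt] at this
    linarith [this.1, hrr x hx]
  have hf1 := hfl (u t x) ⟨hη', hun⟩ t ⟨ht.1, htT.le⟩ x hx
  rw [abs_of_neg hun] at hf1
  have hux0 : 0 ≤ u₀ x := hu₀ x hxΩ
  have hDk : Dk k T (fun τ => u τ x - u₀ x) t ≤ -(-(u t x) * k (t - r)) := by
    refine aux_time hk htT.le ((hut x hx).sub continuousOn_const) (by linarith) (by linarith)
      (by linarith) ?_ ?_ ?_ ?_ (hDkdiff x hx t ⟨ht0, htT.le⟩)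
    · intro s hs
      have := hmin' (t - s) ⟨by linarith [hs.2], by linarith [hs.1, ht.2]⟩ x hx
      linarith
    · intro s hs
      have := hle (t - s) (by linarith [hs.2]) (by linarith [hs.1]) x hx
      linarith
    · linarith
    · simpa using has4 t ⟨ht0, htT.le⟩ x hx
  have hkM := hkρ (t - r) ⟨by linarith, by linarith [ht.2]⟩
  have he := heq t ⟨ht0, htT⟩ x hxΩ
  nlinarith
end

section
/- Under the assumptions of the positivity principle (Ω ⊂ ℝ^n bounded open with smooth boundary; A elliptic with a_{ij}, a_j ∈ C(Ω̄); k ∈ L¹(0,T) ∩ C(0,T] positive, decreasing, k(t) → ∞ as t → 0⁺; f ∈ C(ℝ×[0,T]×Ω̄) with f(w,t,x) ≥ −M|w| for w ∈ (−η,0); u ∈ C([0,T]×Ω̄) with u_{x_j}, u_{x_i x_j} ∈ C((0,T]×Ω̄) and D^{{k}}[u − u_0] ∈ C((0,T]×Ω̄) solving D^{{k}}[u − u_0] = Au + f(u,·,·) on (0,T)×Ω, u(0,·) = u_0 ≥ 0, u = g ≥ 0 on (0,T)×∂Ω, and condition (as4)): if u(t_0,x_0) = 0 at some point (t_0,x_0)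 ∈ (0,T]×Ω, then u(t,x_0) = 0 for every t ∈ [0,t_0]. -/
open Set MeasureTheory Filter Topology

lemma kern_int {k : ℝ → ℝ} {T : ℝ} (hk : KernelOK k T) {a b : ℝ} (ha : a ∈ Icc 0 T) (hb : b ∈ Icc 0 T) :
    IntervalIntegrable k volume a b := by
  have h0 : IntervalIntegrable k volume 0 T := by
    rw [intervalIntegrable_iff_integrableOn_Ioc_of_le (ha.1.trans ha.2)]; exact hk.1
  apply h0.mono_set
  rw [uIcc_of_le (ha.1.trans ha.2)]
  exact uIcc_subset_Icc ha hb

lemma kern_avg {k : ℝ → ℝ} {T : ℝ} (hk : KernelOK k T) {s : ℝ} (hs : s ∈ Ioc 0 T) :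
    Tendsto (fun h => h⁻¹ * ∫ τ in (s-h)..s, k τ) (𝓝[>] 0) (𝓝 (k s)) := by
  obtain ⟨hs0, hsT⟩ := hs
  have hev : ∀ᶠ h in 𝓝[>] (0:ℝ), h ∈ Ioo 0 s := Ioo_mem_nhdsGT hs0
  have hl : Tendsto (fun h => k (s - h)) (𝓝[>] 0) (𝓝 (k s)) := by
    have h1 : Tendsto k (𝓝[Ioc 0 T] s) (𝓝 (k s)) := hk.2.1 s ⟨hs0, hsT⟩
    refine h1.comp (tendsto_nhdsWithin_iff.2 ⟨?_, ?_⟩)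
    · have : Tendsto (fun h : ℝ => s - h) (𝓝 0) (𝓝 (s - 0)) := by
        apply Continuous.tendsto; fun_prop
      rw [sub_zero] at this
      exact this.mono_left nhdsWithin_le_nhds
    · filter_upwards [hev] with h hh
      exact ⟨by linarith [hh.2], by linarith [hh.1]⟩
  refine tendsto_of_tendsto_of_tendsto_of_le_of_le' tendsto_const_nhds hl ?_ ?_
  · filter_upwards [hev] with h hh
    have h1 : ∫ τ in (s-h)..s, (fun _ => k s) τ ≤ ∫ τ in (s-h)..s, k τ := by
      apply intervalIntegral.integral_mono_on (by linarith [hh.1])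
      · simp
      · exact kern_int hk ⟨by linarith [hh.2], by linarith [hh.1]⟩ ⟨hs0.le, hsT⟩
      · intro x hx
        exact hk.2.2.2 x ⟨by linarith [hx.1, hh.2], by linarith [hx.2]⟩ s ⟨hs0, hsT⟩ hx.2
    simp at h1
    rw [inv_mul_eq_div, le_div_iff₀ hh.1]; linarith
  · filter_upwards [hev] with h hh
    have h1 : ∫ τ in (s-h)..s, k τ ≤ ∫ τ in (s-h)..s, (fun _ => k (s-h)) τ := by
      apply intervalIntegral.integral_mono_on (by linarith [hh.1])
      · exact kern_int hk ⟨by linarith [hh.2], by linarith [hh.1]⟩ ⟨hs0.le, hsT⟩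
      · simp
      · intro x hx
        exact hk.2.2.2 (s-h) ⟨by linarith [hh.2], by linarith [hh.1]⟩ x ⟨by linarith [hx.1, hh.2], by linarith [hx.2]⟩ hx.1
    simp at h1
    rw [inv_mul_eq_div, div_le_iff₀ hh.1]; linarith

/-- finite difference bound -/
lemma diff_bound {k : ℝ → ℝ} {T : ℝ} (hk : KernelOK k T) {w : ℝ → ℝ} {w0 t a b c h : ℝ}
    (ht : t ≤ T) (hw : ContinuousOn w (Icc 0 T)) (hh : 0 < h) (hha : h < a)
    (hab : a ≤ b) (hbt : b ≤ t) 
    (hmin : ∀ s ∈ Icc 0 t, w t ≤ w s) (hc : ∀ s ∈ Icc (t - b) (t - a), w t + c ≤ w s) :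
    kConv k (fun τ => w τ - w0) t - kConv k (fun τ => w τ - w0) (t - h) ≤
      (w t - w0) * (∫ τ in (t-h)..t, k τ)
      + (∫ τ in (0:ℝ)..h, k τ) * sSup ((fun s => |w (t - s) - w t|) '' Icc 0 h)
      + c * ((∫ τ in (b-h)..b, k τ) - ∫ τ in (a-h)..a, k τ) := by
  set p : ℝ → ℝ := fun τ => w (t - τ) - w t with hp
  have hpc : ContinuousOn p (Icc 0 t) := by
    refine (hw.comp (by fun_prop) ?_).sub continuousOn_const
    intro x hx; exact ⟨by linarith [hx.2], by linarith [hx.1]⟩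
  have hp0 : ∀ τ ∈ Icc 0 t, 0 ≤ p τ := fun τ hτ => by
    have := hmin (t - τ) ⟨by linarith [hτ.2], by linarith [hτ.1]⟩
    simp only [hp]; linarith
  have hpcc : ∀ τ ∈ Icc a b, c ≤ p τ := fun τ hτ => by
    have := hc (t - τ) ⟨by linarith [hτ.2], by linarith [hτ.1]⟩
    simp only [hp]; linarith
  have I : ∀ x y, x ∈ Icc 0 t → y ∈ Icc 0 t → IntervalIntegrable k volume x y := fun x y hx hy =>
    kern_int hk ⟨hx.1, hx.2.trans ht⟩ ⟨hy.1, hy.2.trans ht⟩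
  have Is : ∀ x y, x ∈ Icc h t → y ∈ Icc h t → IntervalIntegrable (fun τ => k (τ - h)) volume x y := by
    intro x y hx hy
    have := (I (x-h) (y-h) ⟨by linarith [hx.1], by linarith [hx.2]⟩ ⟨by linarith [hy.1], by linarith [hy.2]⟩).comp_sub_right h
    simpa using this
  have hpI : ∀ x y, x ∈ Icc 0 t → y ∈ Icc 0 t → ContinuousOn p (uIcc x y) := fun x y hx hy =>
    hpc.mono (uIcc_subset_Icc hx hy)
  have Ip : ∀ x y, x ∈ Icc 0 t → y ∈ Icc 0 t → IntervalIntegrable (fun τ => k τ * p τ) volume x y :=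
    fun x y hx hy => (I x y hx hy).mul_continuousOn (hpI x y hx hy)
  have sub : ∀ {x}, x ∈ Icc h t → x ∈ Icc 0 t := fun hx => ⟨hh.le.trans hx.1, hx.2⟩
  have Isp : ∀ x y, x ∈ Icc h t → y ∈ Icc h t → IntervalIntegrable (fun τ => k (τ - h) * p τ) volume x y :=
    fun x y hx hy => (Is x y hx hy).mul_continuousOn (hpI x y (sub hx) (sub hy))
  have m0 : (0:ℝ) ∈ Icc 0 t := ⟨le_rfl, by linarith⟩
  have mt : t ∈ Icc h t := ⟨by linarith, le_rfl⟩
  have mh : h ∈ Icc h t := ⟨le_rfl, by linarith⟩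
  have ma : a ∈ Icc h t := ⟨by linarith, by linarith⟩
  have mb : b ∈ Icc h t := ⟨by linarith, by linarith⟩
  have F1 : kConv k (fun τ => w τ - w0) t = (w t - w0) * (∫ τ in (0:ℝ)..t, k τ) + ∫ τ in (0:ℝ)..t, k τ * p τ := by
    have e := intervalIntegral.integral_comp_sub_left (fun τ => k τ * (w (t - τ) - w0)) t (a := 0) (b := t)
    simp only [sub_sub_cancel, sub_self, sub_zero] at e
    unfold kConv
    rw [e, ← intervalIntegral.integral_const_mul, ← intervalIntegral.integral_add]
    · congr 1; ext τ; simp only [hp]; ring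
    · exact (I _ _ m0 (sub mt)).const_mul _
    · exact Ip _ _ m0 (sub mt)
  have F2 : kConv k (fun τ => w τ - w0) (t - h) =
      (w t - w0) * (∫ τ in (0:ℝ)..(t-h), k τ) + ∫ τ in h..t, k (τ - h) * p τ := by
    have e := intervalIntegral.integral_comp_sub_left (fun τ => k (τ - h) * (w (t - τ) - w0)) t (a := 0) (b := t - h)
    simp only [sub_sub_cancel, sub_zero] at e
    have e2 := intervalIntegral.integral_comp_sub_right k h (a := h) (b := t)
    simp only [sub_self] at e2
    unfold kConv
    rw [← e2, ← intervalIntegral.integral_const_mul, ← intervalIntegral.integral_add]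
    · rw [show (fun τ => k (t - h - τ) * (w τ - w0)) = fun τ => k (t - τ - h) * (w τ - w0) by
        ext τ; congr 2; ring]
      rw [e]
      congr 1; ext τ; simp only [hp]; ring
    · exact (Is _ _ mh mt).const_mul _
    · exact Isp _ _ mh mt
  have S1 : (∫ τ in (0:ℝ)..t, k τ) - (∫ τ in (0:ℝ)..(t-h), k τ) = ∫ τ in (t-h)..t, k τ :=
    intervalIntegral.integral_interval_sub_left (I _ _ m0 (sub mt)) (I _ _ m0 ⟨by linarith, by linarith⟩)
  have S2 : ∫ τ in (0:ℝ)..t, k τ * p τ = (∫ τ in (0:ℝ)..h, k τ * p τ) + (∫ τ in h..a, k τ * p τ)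
      + (∫ τ in a..b, k τ * p τ) + ∫ τ in b..t, k τ * p τ := by
    rw [intervalIntegral.integral_add_adjacent_intervals (Ip _ _ m0 (sub mh)) (Ip _ _ (sub mh) (sub ma)),
      intervalIntegral.integral_add_adjacent_intervals (Ip _ _ m0 (sub ma)) (Ip _ _ (sub ma) (sub mb)),
      intervalIntegral.integral_add_adjacent_intervals (Ip _ _ m0 (sub mb)) (Ip _ _ (sub mb) (sub mt))]
  have S3 : ∫ τ in h..t, k (τ - h) * p τ = (∫ τ in h..a, k (τ - h) * p τ)
      + (∫ τ in a..b, k (τ - h) * p τ) + ∫ τ in b..t, k (τ - h) * p τ := by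
    rw [intervalIntegral.integral_add_adjacent_intervals (Isp _ _ mh ma) (Isp _ _ ma mb),
      intervalIntegral.integral_add_adjacent_intervals (Isp _ _ mh mb) (Isp _ _ mb mt)]
  have kk : ∀ τ, h < τ → τ ≤ t → k τ ≤ k (τ - h) := fun τ h1 h2 =>
    hk.2.2.2 _ ⟨by linarith, by linarith⟩ _ ⟨by linarith, by linarith⟩ (by linarith)
  have B1 : ∫ τ in h..a, k τ * p τ ≤ ∫ τ in h..a, k (τ - h) * p τ := by
    apply intervalIntegral.integral_mono_on_of_le_Ioo ma.1 (Ip _ _ (sub mh) (sub ma)) (Isp _ _ mh ma)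
    intro x hx
    exact mul_le_mul_of_nonneg_right (kk x hx.1 (by linarith [hx.2])) (hp0 x ⟨by linarith [hx.1], by linarith [hx.2]⟩)
  have B2 : ∫ τ in b..t, k τ * p τ ≤ ∫ τ in b..t, k (τ - h) * p τ := by
    apply intervalIntegral.integral_mono_on_of_le_Ioo hbt (Ip _ _ (sub mb) (sub mt)) (Isp _ _ mb mt)
    intro x hx
    exact mul_le_mul_of_nonneg_right (kk x (by linarith [hx.1]) (by linarith [hx.2])) (hp0 x ⟨by linarith [hx.1], by linarith [hx.2]⟩)
  have B3 : (∫ τ in a..b, k τ * p τ) - (∫ τ in a..b, k (τ - h) * p τ) ≤ 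
      c * ((∫ τ in a..b, k τ) - ∫ τ in a..b, k (τ - h)) := by
    rw [← intervalIntegral.integral_sub (Ip _ _ (sub ma) (sub mb)) (Isp _ _ ma mb),
      ← intervalIntegral.integral_sub (I _ _ (sub ma) (sub mb)) (Is _ _ ma mb),
      ← intervalIntegral.integral_const_mul]
    apply intervalIntegral.integral_mono_on hab ((Ip _ _ (sub ma) (sub mb)).sub (Isp _ _ ma mb))
      (((I _ _ (sub ma) (sub mb)).sub (Is _ _ ma mb)).const_mul _)
    intro x hx
    have h1 := kk x (by linarith [hx.1]) (by linarith [hx.2])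
    have h2 := hpcc x hx
    nlinarith
  have B4 : (∫ τ in a..b, k τ) - (∫ τ in a..b, k (τ - h)) = (∫ τ in (b-h)..b, k τ) - ∫ τ in (a-h)..a, k τ := by
    rw [intervalIntegral.integral_comp_sub_right k h]
    have ma' : a - h ∈ Icc 0 t := ⟨by linarith, by linarith⟩
    have mb' : b - h ∈ Icc 0 t := ⟨by linarith, by linarith⟩
    have e1 := intervalIntegral.integral_add_adjacent_intervals (I _ _ ma' (sub ma)) (I _ _ (sub ma) (sub mb))
    have e2 := intervalIntegral.integral_add_adjacent_intervals (I _ _ ma' mb') (I _ _ mb' (sub mb))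
    linarith
  have B5 : (∫ τ in (0:ℝ)..h, k τ * p τ) ≤ (∫ τ in (0:ℝ)..h, k τ) * sSup ((fun s => |w (t - s) - w t|) '' Icc 0 h) := by
    rw [← intervalIntegral.integral_mul_const]
    apply intervalIntegral.integral_mono_on_of_le_Ioo hh.le (Ip _ _ m0 (sub mh)) ((I _ _ m0 (sub mh)).mul_const _)
    intro x hx
    apply mul_le_mul_of_nonneg_left _ (hk.2.2.1 x ⟨hx.1, by linarith [hx.2]⟩).le
    have hbd : BddAbove ((fun s => |w (t - s) - w t|) '' Icc 0 h) := by
      apply IsCompact.bddAbove_image isCompact_Icc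
      exact (hpc.mono (Icc_subset_Icc le_rfl mh.2)).abs
    exact (le_abs_self _).trans (le_csSup hbd ⟨x, ⟨hx.1.le, hx.2.le⟩, rfl⟩)
  rw [F1, F2, S2, S3, ← S1, ← B4]
  linarith

lemma Dk_bound {k : ℝ → ℝ} {T : ℝ} (hk : KernelOK k T) {w : ℝ → ℝ} {w0 t a b c : ℝ}
    (ht : t ≤ T) (hw : ContinuousOn w (Icc 0 T)) (ha : 0 < a)
    (hab : a ≤ b) (hbt : b ≤ t)
    (hmin : ∀ s ∈ Icc 0 t, w t ≤ w s) (hc : ∀ s ∈ Icc (t - b) (t - a), w t + c ≤ w s)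
    (hd : DifferentiableWithinAt ℝ (kConv k (fun τ => w τ - w0)) (Icc 0 T) t)
    (has : Tendsto (fun ε => ε⁻¹ * (∫ τ in (0:ℝ)..ε, k τ) *
        sSup ((fun s => |w (t - s) - w t|) '' Icc 0 ε)) (𝓝[>] 0) (𝓝 0)) :
    Dk k T (fun τ => w τ - w0) t ≤ k t * (w t - w0) - c * (k a - k b) := by
  have ht0 : 0 < t := by linarith
  set F := kConv k (fun τ => w τ - w0) with hF
  have h1 : HasDerivWithinAt F (Dk k T (fun τ => w τ - w0) t) (Icc 0 T) t := hd.hasDerivWithinAt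
  rw [hasDerivWithinAt_iff_tendsto_slope] at h1
  have hm : Tendsto (fun h : ℝ => t - h) (𝓝[>] 0) (𝓝[Icc 0 T \ {t}] t) := by
    refine tendsto_nhdsWithin_iff.2 ⟨?_, ?_⟩
    · have : Tendsto (fun h : ℝ => t - h) (𝓝 0) (𝓝 (t - 0)) := by
        apply Continuous.tendsto; fun_prop
      rw [sub_zero] at this
      exact this.mono_left nhdsWithin_le_nhds
    · filter_upwards [Ioo_mem_nhdsGT ht0] with h hh
      refine ⟨⟨by linarith [hh.2], by linarith [hh.1]⟩, ?_⟩
      simp; exact hh.1.ne'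
  have h2 := h1.comp hm
  have h3 := ((((kern_avg hk ⟨ht0, ht⟩).mul_const (w t - w0)).add has).add
    (((kern_avg hk (s := b) ⟨by linarith, by linarith⟩).sub (kern_avg hk (s := a) ⟨ha, by linarith⟩)).const_mul c))
  have : k t * (w t - w0) - c * (k a - k b) = k t * (w t - w0) + 0 + c * (k b - k a) := by ring
  rw [this]
  refine le_of_tendsto_of_tendsto h2 h3 ?_
  filter_upwards [Ioo_mem_nhdsGT ha] with h hh
  have := diff_bound hk (w0 := w0) ht hw hh.1 hh.2 hab hbt hmin hc
  have e : (slope F t ∘ fun h => t - h) h = h⁻¹ * (F t - F (t - h)) := by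
    simp only [Function.comp, slope_def_field]
    rw [show t - h - t = -h by ring, div_neg, inv_mul_eq_div, ← neg_div, neg_sub]
  rw [e]
  have := mul_le_mul_of_nonneg_left this (inv_nonneg.2 hh.1.le)
  refine this.trans (le_of_eq ?_)
  ring

lemma pd_eq_dir {n : ℕ} {v : (Fin n → ℝ) → ℝ} (y ξ : Fin n → ℝ) :
    fderiv ℝ v y ξ = ∑ i, ξ i * pd i v y := by
  conv_lhs => rw [← Finset.univ_sum_single ξ]
  rw [map_sum]
  refine Finset.sum_congr rfl fun i _ => ?_
  have : (Pi.single i (ξ i) : Fin n → ℝ) = ξ i • Pi.single i 1 := by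
    rw [← Pi.single_smul]; simp
  rw [this, map_smul, smul_eq_mul]; rfl

lemma fderiv_diff {n : ℕ} {v : (Fin n → ℝ) → ℝ} {x : Fin n → ℝ}
    (h : ∀ j, DifferentiableAt ℝ (pd j v) x) : DifferentiableAt ℝ (fderiv ℝ v) x := by
  have : fderiv ℝ v = fun y => ∑ i, pd i v y • (ContinuousLinearMap.proj i : (Fin n → ℝ) →L[ℝ] ℝ) := by
    ext1 y; ext1 ξ
    rw [pd_eq_dir]
    simp [mul_comm]
  rw [this]
  fun_prop

lemma hess_psd {n : ℕ} {v : (Fin n → ℝ) → ℝ} {x : Fin n → ℝ} {Ω : Set (Fin n → ℝ)} (hΩ : IsOpen Ω) (hx : x ∈ Ω)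
    (hd : ∀ y ∈ Ω, DifferentiableAt ℝ v y ∧ ∀ j, DifferentiableAt ℝ (pd j v) y)
    (hm : IsLocalMin v x) (ξ : Fin n → ℝ) : 0 ≤ ∑ i, ∑ j, ξ i * ξ j * pd i (pd j v) x := by
  by_contra! hneg
  set φ : ℝ → ℝ := fun s => v (x + s • ξ) with hφ
  have hl : ∀ s, HasDerivAt (fun s : ℝ => x + s • ξ) ξ s := fun s => by
    simpa using ((hasDerivAt_id s).smul_const ξ).const_add x
  have hcont : Continuous (fun s : ℝ => x + s • ξ) := by fun_prop
  have hev : ∀ᶠ s : ℝ in 𝓝 0, x + s • ξ ∈ Ω := by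
    apply hcont.continuousAt.eventually_mem
    simpa using hΩ.mem_nhds hx
  have h1 : ∀ s, x + s • ξ ∈ Ω → HasDerivAt φ (∑ j, ξ j * pd j v (x + s • ξ)) s := by
    intro s hs
    rw [← pd_eq_dir]
    exact (hd _ hs).1.hasFDerivAt.comp_hasDerivAt s (hl s)
  have h1' : deriv φ =ᶠ[𝓝 0] fun s => ∑ j, ξ j * pd j v (x + s • ξ) := by
    filter_upwards [hev] with s hs using (h1 s hs).deriv
  have h2 : HasDerivAt (fun s : ℝ => ∑ j, ξ j * pd j v (x + s • ξ)) (∑ j, ξ j * ∑ i, ξ i * pd i (pd j v) x) (0:ℝ) := by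
    apply HasDerivAt.fun_sum
    intro j _
    apply HasDerivAt.const_mul
    rw [← pd_eq_dir]
    have hh : HasFDerivAt (pd j v) (fderiv ℝ (pd j v) x) (x + (0:ℝ) • ξ) := by
      simpa using ((hd x hx).2 j).hasFDerivAt
    exact hh.comp_hasDerivAt (0:ℝ) (hl 0)
  have hdd : deriv (deriv φ) 0 = ∑ i, ∑ j, ξ i * ξ j * pd i (pd j v) x := by
    rw [h1'.deriv_eq, h2.deriv, Finset.sum_comm]
    refine Finset.sum_congr rfl fun j _ => ?_
    rw [Finset.mul_sum]
    refine Finset.sum_congr rfl fun i _ => by ring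
  have hmφ : IsLocalMin φ 0 := by
    have : Tendsto (fun s : ℝ => x + s • ξ) (𝓝 0) (𝓝 x) := by
      simpa using hcont.tendsto 0
    have := this.eventually hm
    filter_upwards [this] with s hs
    simpa [hφ] using hs
  have h0 : deriv φ 0 = 0 := hmφ.deriv_eq_zero
  have hx0 : x + (0:ℝ) • ξ ∈ Ω := by simpa using hx
  have hmax := isLocalMax_of_deriv_deriv_neg (by rw [hdd]; exact hneg) h0 (h1 0 hx0).continuousAt
  have hconst : φ =ᶠ[𝓝 0] fun _ => φ 0 := by
    filter_upwards [hmax, hmφ] with s a b using le_antisymm a b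
  have : deriv (deriv φ) 0 = 0 := by
    have := hconst.deriv.deriv_eq
    simpa using this
  linarith [hdd]

lemma ellOp_nonneg {n : ℕ} {v : (Fin n → ℝ) → ℝ} {x : Fin n → ℝ} {Ω : Set (Fin n → ℝ)} (hΩ : IsOpen Ω) (hx : x ∈ Ω)
    {aC : Fin n → Fin n → (Fin n → ℝ) → ℝ} {bC : Fin n → (Fin n → ℝ) → ℝ} (hell : IsElliptic aC Ω)
    (hd : ∀ y ∈ Ω, DifferentiableAt ℝ v y ∧ ∀ j, DifferentiableAt ℝ (pd j v) y)
    (hm : IsLocalMin v x) : 0 ≤ ellOp aC bC v x := by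
  have hp : ∀ j, pd j v x = 0 := fun j => by
    unfold pd; rw [hm.fderiv_eq_zero]; rfl
  have hsym : ∀ i j, pd i (pd j v) x = pd j (pd i v) x := by
    have key : ∀ i j, pd i (pd j v) x = fderiv ℝ (fderiv ℝ v) x (Pi.single i 1) (Pi.single j 1) := by
      intro i j
      have h1 := (fderiv_diff (hd x hx).2).hasFDerivAt
      have := h1.clm_apply (hasFDerivAt_const (Pi.single j (1:ℝ) : Fin n → ℝ) x)
      have h2 : fderiv ℝ (pd j v) x = _ := this.fderiv
      unfold pd at h2 ⊢
      rw [h2]; simp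
    intro i j
    rw [key, key]
    apply second_derivative_symmetric_of_eventually (f := v) (f' := fderiv ℝ v) (x := x)
    · filter_upwards [hΩ.mem_nhds hx] with y hy using (hd y hy).1.hasFDerivAt
    · exact (fderiv_diff (hd x hx).2).hasFDerivAt
  let H : Matrix (Fin n) (Fin n) ℝ := Matrix.of fun i j => pd i (pd j v) x
  have hH : H.PosSemidef := by
    refine Matrix.PosSemidef.of_dotProduct_mulVec_nonneg ?_ ?_
    · ext i j; simp [H, hsym i j]
    · intro ξ
      have := hess_psd hΩ hx hd hm ξ
      refine this.trans (le_of_eq ?_)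
      simp only [dotProduct, Matrix.mulVec, H, Matrix.of_apply, star_trivial, Finset.mul_sum]
      refine Finset.sum_congr rfl fun i _ => Finset.sum_congr rfl fun j _ => by ring
  obtain ⟨B, hB⟩ : ∃ B : Matrix (Fin n) (Fin n) ℝ, H = B.transpose * B := by
    open scoped MatrixOrder in
    obtain ⟨B, hB⟩ := CStarAlgebra.nonneg_iff_eq_star_mul_self.mp hH.nonneg
    exact ⟨B, by rw [hB, Matrix.star_eq_conjTranspose, Matrix.conjTranspose_eq_transpose_of_trivial]⟩
  have hHB : ∀ i j, pd i (pd j v) x = ∑ l, B l i * B l j := fun i j => by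
    have := congrFun (congrFun hB i) j
    simpa [H, Matrix.mul_apply] using this
  unfold ellOp
  simp only [hp, mul_zero, Finset.sum_const_zero, add_zero, hHB, Finset.mul_sum]
  have : ∑ i, ∑ j, ∑ l, aC i j x * (B l i * B l j) = ∑ l, ∑ i, ∑ j, aC i j x * B l i * B l j := by
    rw [Finset.sum_comm' (s := Finset.univ) (t := fun _ => Finset.univ) (t' := Finset.univ) (s' := fun _ => Finset.univ) (by simp)]
    rw [Finset.sum_congr rfl (fun j _ => Finset.sum_comm), Finset.sum_comm]
    refine Finset.sum_congr rfl fun l _ => ?_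
    rw [Finset.sum_comm]
    refine Finset.sum_congr rfl fun i _ => Finset.sum_congr rfl fun j _ => by ring
  rw [this]
  obtain ⟨c, hc, he⟩ := hell
  refine Finset.sum_nonneg fun l _ => le_trans ?_ (he x hx (B l))
  exact mul_nonneg hc.le (Finset.sum_nonneg fun i _ => sq_nonneg _)

/-- **Theorem 2(ii), Dirichlet case.**  Under the assumptions of the positivity principle,
if `u(t₀,x₀) = 0` at some `(t₀,x₀) ∈ (0,T] × Ω`, then `u(t,x₀) = 0` for all `t ∈ [0,t₀]`. -/
theorem zero_propagates_backwards {n : ℕ}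
    (T : ℝ) (hT : 0 < T)
    (Ω : Set (Fin n → ℝ)) (hΩo : IsOpen Ω) (hΩb : Bornology.IsBounded Ω)
    (aC : Fin n → Fin n → (Fin n → ℝ) → ℝ) (bC : Fin n → (Fin n → ℝ) → ℝ)
    (haC : ∀ i j, ContinuousOn (aC i j) (closure Ω))
    (hbC : ∀ j, ContinuousOn (bC j) (closure Ω))
    (hell : IsElliptic aC Ω)
    (k : ℝ → ℝ) (hk : KernelOK k T)
    (hkinf : Tendsto k (𝓝[>] 0) atTop)
    (f : ℝ → ℝ → (Fin n → ℝ) → ℝ)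
    (hf : ContinuousOn (fun p : ℝ × ℝ × (Fin n → ℝ) => f p.1 p.2.1 p.2.2)
      ((univ : Set ℝ) ×ˢ (Icc 0 T ×ˢ closure Ω)))
    (hflow : ∃ M ≥ (0:ℝ), ∃ η > (0:ℝ), ∀ w ∈ Ioo (-η) (0:ℝ), ∀ t ∈ Icc (0:ℝ) T,
      ∀ x ∈ closure Ω, -M * |w| ≤ f w t x)
    (u : ℝ → (Fin n → ℝ) → ℝ) (u₀ : (Fin n → ℝ) → ℝ) (g : ℝ → (Fin n → ℝ) → ℝ)
    (hu : ContinuousOn (fun p : ℝ × (Fin n → ℝ) => u p.1 p.2) (Icc 0 T ×ˢ closure Ω))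
    (hux : ∀ j, ContinuousOn (fun p : ℝ × (Fin n → ℝ) => pd j (u p.1) p.2)
      (Ioc 0 T ×ˢ closure Ω))
    (huxx : ∀ i j, ContinuousOn (fun p : ℝ × (Fin n → ℝ) => pd i (pd j (u p.1)) p.2)
      (Ioc 0 T ×ˢ closure Ω))
    (hudiff : ∀ t ∈ Ioc (0:ℝ) T, ∀ x ∈ Ω,
      DifferentiableAt ℝ (u t) x ∧ ∀ j, DifferentiableAt ℝ (pd j (u t)) x)
    (hDkdiff : ∀ x ∈ closure Ω, ∀ t ∈ Ioc (0:ℝ) T,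
      DifferentiableWithinAt ℝ (kConv k (fun τ => u τ x - u₀ x)) (Icc 0 T) t)
    (hDkcont : ContinuousOn
      (fun p : ℝ × (Fin n → ℝ) => Dk k T (fun τ => u τ p.2 - u₀ p.2) p.1)
      (Ioc 0 T ×ˢ closure Ω))
    (heq : ∀ t ∈ Ioo (0:ℝ) T, ∀ x ∈ Ω,
      Dk k T (fun τ => u τ x - u₀ x) t = ellOp aC bC (u t) x + f (u t x) t x)
    (hinit : ∀ x ∈ closure Ω, u 0 x = u₀ x)
    (hbc : ∀ t ∈ Ioo (0:ℝ) T, ∀ x ∈ frontier Ω, u t x = g t x)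
    (has4 : As4 k T Ω u)
    (hu₀ : ∀ x ∈ Ω, 0 ≤ u₀ x)
    (hg : ∀ t ∈ Ioo (0:ℝ) T, ∀ x ∈ frontier Ω, 0 ≤ g t x)
    (t₀ : ℝ) (x₀ : Fin n → ℝ) (ht₀ : t₀ ∈ Ioc (0:ℝ) T) (hx₀ : x₀ ∈ Ω)
    (hzero : u t₀ x₀ = 0) :
    ∀ t ∈ Icc (0:ℝ) t₀, u t x₀ = 0 := by
  classical
  have hu_t : ∀ x ∈ closure Ω, ContinuousOn (fun t => u t x) (Icc 0 T) := fun x hx =>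
    hu.comp (f := fun t : ℝ => (t, x)) (by fun_prop) (fun t ht => ⟨ht, hx⟩)
  have hu_x : ∀ t ∈ Icc 0 T, ContinuousOn (u t) (closure Ω) := fun t ht =>
    hu.comp (f := fun x : Fin n → ℝ => (t, x)) (by fun_prop) (fun x hx => ⟨ht, hx⟩)
  -- the equation holds up to time T
  have heqT : ∀ t ∈ Ioc (0:ℝ) T, ∀ x ∈ Ω,
      Dk k T (fun τ => u τ x - u₀ x) t = ellOp aC bC (u t) x + f (u t x) t x := by
    intro t ht x hx
    have hxc := subset_closure hx
    have hmaps : MapsTo (fun t : ℝ => (t, x)) (Ioc 0 T) (Ioc 0 T ×ˢ closure Ω) :=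
      fun t ht => ⟨ht, hxc⟩
    have key : EqOn (fun t => Dk k T (fun τ => u τ x - u₀ x) t)
        (fun t => ellOp aC bC (u t) x + f (u t x) t x) (Ioc 0 T) := by
      refine Set.EqOn.of_subset_closure (s := Ioo 0 T) (fun t ht => heq t ht x hx) ?_ ?_
        Ioo_subset_Ioc_self ?_
      · exact hDkcont.comp (f := fun t : ℝ => (t, x)) (by fun_prop) hmaps
      · refine ContinuousOn.add ?_ ?_
        · unfold ellOp
          refine ContinuousOn.add ?_ ?_
          · refine continuousOn_finsetSum _ fun i _ => continuousOn_finsetSum _ fun j _ => ?_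
            exact continuousOn_const.mul
              ((huxx i j).comp (f := fun t : ℝ => (t, x)) (by fun_prop) hmaps)
          · refine continuousOn_finsetSum _ fun j _ => ?_
            exact continuousOn_const.mul
              ((hux j).comp (f := fun t : ℝ => (t, x)) (by fun_prop) hmaps)
        · have h1 : ContinuousOn (fun t => (u t x, t, x)) (Ioc 0 T) :=
            ((hu_t x hxc).mono Ioc_subset_Icc_self).prodMk (by fun_prop)
          exact hf.comp h1 (fun t ht => ⟨mem_univ _, Ioc_subset_Icc_self ht, hxc⟩)
      · rw [closure_Ioo hT.ne]; exact Ioc_subset_Icc_self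
    exact key ht
  have hbd : ∀ t ∈ Icc 0 T, ∀ x ∈ frontier Ω, 0 ≤ u t x := by
    intro t ht x hx
    have hxc := frontier_subset_closure hx
    refine le_on_closure (s := Ioo 0 T) (f := fun _ => (0:ℝ)) (g := fun t => u t x) ?_
      continuousOn_const ?_ ?_
    · intro s hs; simp only [hbc s hs x hx]; exact hg s hs x hx
    · rw [closure_Ioo hT.ne]; exact hu_t x hxc
    · rw [closure_Ioo hT.ne]; exact ht
  have hini : ∀ x ∈ closure Ω, 0 ≤ u 0 x := by
    intro x hx
    refine le_on_closure (s := Ω) (f := fun _ => (0:ℝ)) (g := u 0) ?_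
      continuousOn_const (hu_x 0 ⟨le_rfl, hT.le⟩) hx
    intro y hy
    rw [hinit y (subset_closure hy)]; exact hu₀ y hy
  obtain ⟨M, hM, η, hη, hflow⟩ := hflow
  have hf0 : ∀ t ∈ Icc 0 T, ∀ x ∈ closure Ω, 0 ≤ f 0 t x := by
    intro t ht x hx
    have hne : (-η) ≠ 0 := by linarith
    have := le_on_closure (s := Ioo (-η) 0) (f := fun w => -M * |w|) (g := fun w => f w t x) (x := 0)
      (fun w hw => hflow w hw t ht x hx) (by fun_prop)
      ((hf.comp (f := fun w : ℝ => (w, t, x)) (s := univ) (by fun_prop)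
        (fun w _ => ⟨mem_univ _, ht, hx⟩)).mono (subset_univ _))
      (by rw [closure_Ioo hne]; exact ⟨by linarith, le_rfl⟩)
    simpa using this
  -- positivity
  obtain ⟨δ, hδ, hkδ⟩ : ∃ δ > 0, ∀ s ∈ Ioc 0 δ, M < k s := by
    have := hkinf.eventually_gt_atTop M
    rw [eventually_nhdsWithin_iff, Metric.eventually_nhds_iff] at this
    obtain ⟨ε, hε, h⟩ := this
    refine ⟨ε / 2, by positivity, fun s hs => h ?_ hs.1⟩
    rw [Real.dist_eq, sub_zero, abs_of_pos hs.1]; linarith [hs.2]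
  have hcomp : IsCompact (closure Ω) := hΩb.isCompact_closure
  have step : ∀ r, 0 ≤ r → (∀ t ∈ Icc 0 T, t ≤ r → ∀ x ∈ closure Ω, 0 ≤ u t x) →
      (∀ t ∈ Icc 0 T, t ≤ r + δ → ∀ x ∈ closure Ω, 0 ≤ u t x) := by
    intro r hr0 hr t ht htr x hx
    by_contra! hneg
    obtain ⟨lam, hl0, hl1⟩ : ∃ lam, 0 < lam ∧ lam < min η (-u t x) :=
      exists_between (lt_min hη (by linarith))
    have hlη := hl1.trans_le (min_le_left _ _)
    have hlu := hl1.trans_le (min_le_right _ _)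
    have hK : IsCompact (Icc 0 T ×ˢ closure Ω) := isCompact_Icc.prod hcomp
    have hS : IsCompact ((Icc 0 T ×ˢ closure Ω) ∩ (fun p : ℝ × (Fin n → ℝ) => u p.1 p.2) ⁻¹' Iic (-lam)) :=
      hK.of_isClosed_subset (hu.preimage_isClosed_of_isClosed hK.isClosed isClosed_Iic) inter_subset_left
    obtain ⟨⟨t1, x1⟩, ⟨⟨ht1, hx1⟩, hle⟩, hmin⟩ := hS.exists_isMinOn
      ⟨(t, x), ⟨ht, hx⟩, by simp only [mem_preimage, mem_Iic]; linarith⟩ continuous_fst.continuousOn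
    simp only [mem_preimage, mem_Iic] at hle ht1 hx1
    have hmin' : ∀ s ∈ Icc 0 T, ∀ y ∈ closure Ω, u s y ≤ -lam → t1 ≤ s := by
      intro s hs y hy h
      exact hmin (a := (s, y)) ⟨⟨hs, hy⟩, h⟩
    have ht1r : r < t1 := by
      by_contra! h
      have := hr t1 ht1 h x1 hx1
      linarith
    have ht1pos : 0 < t1 := by linarith
    have ht1le : t1 ≤ t := hmin' t ht x hx (by linarith)
    have hge : ∀ s ∈ Icc 0 t1, ∀ y ∈ closure Ω, -lam ≤ u s y := by
      intro s hs y hy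
      refine le_on_closure (s := Ico 0 t1) (f := fun _ => -lam) (g := fun t => u t y) ?_
        continuousOn_const ?_ ?_
      · intro s hs
        by_contra! h
        have := hmin' s ⟨hs.1, hs.2.le.trans ht1.2⟩ y hy h.le
        linarith [hs.2]
      · rw [closure_Ico ht1pos.ne]; exact (hu_t y hy).mono (Icc_subset_Icc le_rfl ht1.2)
      · rw [closure_Ico ht1pos.ne]; exact hs
    have huv : u t1 x1 = -lam := le_antisymm hle (hge t1 ⟨ht1pos.le, le_rfl⟩ x1 hx1)
    have hx1Ω : x1 ∈ Ω := by
      by_contra h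
      have hfr : x1 ∈ frontier Ω := by
        rw [hΩo.frontier_eq]; exact ⟨hx1, h⟩
      have := hbd t1 ht1 x1 hfr
      linarith
    have hloc : IsLocalMin (u t1) x1 := by
      filter_upwards [hΩo.mem_nhds hx1Ω] with y hy
      rw [huv]; exact hge t1 ⟨ht1pos.le, le_rfl⟩ y (subset_closure hy)
    have ht1' : t1 ∈ Ioc 0 T := ⟨ht1pos, ht1.2⟩
    have e1 := heqT t1 ht1' x1 hx1Ω
    have e2 := ellOp_nonneg (bC := bC) hΩo hx1Ω hell (hudiff t1 ht1') hloc
    have e3 := hflow (u t1 x1) ⟨by linarith, by linarith⟩ t1 ht1 x1 hx1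
    have e4 := Dk_bound hk (w := fun t => u t x1) (w0 := u₀ x1) (t := t1) (a := t1 - r) (b := t1) (c := lam)
      ht1.2 (hu_t x1 hx1) (by linarith) (by linarith) le_rfl
      (fun s hs => by simp only [huv]; exact hge s hs x1 hx1)
      (fun s hs => by
        simp only [huv]
        have := hr s ⟨by linarith [hs.1], by linarith [hs.2, ht1.2]⟩ (by linarith [hs.2]) x1 hx1
        linarith)
      (hDkdiff x1 hx1 t1 ht1') (has4 t1 ht1' x1 hx1)
    simp only [huv] at e1 e3 e4
    rw [abs_neg, abs_of_pos hl0] at e3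
    have e5 := hkδ (t1 - r) ⟨by linarith, by linarith⟩
    have e6 := hu₀ x1 hx1Ω
    have e7 := hk.2.2.1 t1 ht1'
    have e8 : 0 ≤ k t1 * u₀ x1 := mul_nonneg e7.le e6
    have e9 : M * lam < k (t1 - r) * lam := mul_lt_mul_of_pos_right e5 hl0
    nlinarith
  have hpos : ∀ t ∈ Icc 0 T, ∀ x ∈ closure Ω, 0 ≤ u t x := by
    have hind : ∀ m : ℕ, ∀ t ∈ Icc 0 T, t ≤ m * δ → ∀ x ∈ closure Ω, 0 ≤ u t x := by
      intro m
      induction m with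
      | zero =>
        intro t ht h x hx
        have : t = 0 := le_antisymm (by simpa using h) ht.1
        rw [this]; exact hini x hx
      | succ m ih =>
        have := step (m * δ) (by positivity) ih
        intro t ht h
        exact this t ht (by push_cast at h; linarith)
    obtain ⟨m, hm⟩ := exists_nat_ge (T / δ)
    rw [div_le_iff₀ hδ] at hm
    intro t ht
    exact hind m t ht (ht.2.trans hm)
  -- backwards propagation
  have hx₀c := subset_closure hx₀
  intro t ht
  by_contra hne
  have hwc : ContinuousOn (fun t => u t x₀) (Icc t t₀) :=
    (hu_t x₀ hx₀c).mono (Icc_subset_Icc ht.1 ht₀.2)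
  have hZ : IsCompact (Icc t t₀ ∩ (fun t => u t x₀) ⁻¹' {0}) :=
    isCompact_Icc.of_isClosed_subset (hwc.preimage_isClosed_of_isClosed isClosed_Icc isClosed_singleton)
      inter_subset_left
  obtain ⟨z, ⟨⟨htz, hzt₀⟩, hz⟩, hzmin⟩ := hZ.exists_isMinOn ⟨t₀, ⟨ht.2, le_rfl⟩, hzero⟩ continuousOn_id
  have hz : u z x₀ = 0 := hz
  have htz : t < z := lt_of_le_of_ne htz (fun h => hne (h ▸ hz))
  have hz0 : 0 < z := ht.1.trans_lt htz
  have hzT : z ∈ Ioc 0 T := ⟨hz0, hzt₀.trans ht₀.2⟩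
  -- choose a < b small with k b < k a
  have hbb : 0 < (z - t) / 2 := by linarith
  obtain ⟨a, ha, hab, hka⟩ : ∃ a, 0 < a ∧ a < (z - t) / 2 ∧ k ((z - t) / 2) < k a := by
    have := (hkinf.eventually_gt_atTop (k ((z - t) / 2))).and (Ioo_mem_nhdsGT hbb)
    obtain ⟨a, h1, h2⟩ := this.exists
    exact ⟨a, h2.1, h2.2, h1⟩
  set b := (z - t) / 2 with hb
  have hsub : Icc (z - b) (z - a) ⊆ Icc 0 T := fun s hs => ⟨by linarith [hs.1, ht.1], by linarith [hs.2, hzT.2]⟩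
  obtain ⟨s0, hs0, hs0min⟩ := isCompact_Icc.exists_isMinOn (f := fun t => u t x₀) (s := Icc (z - b) (z - a))
    ⟨z - a, by linarith, le_rfl⟩ ((hu_t x₀ hx₀c).mono hsub)
  have hcpos : 0 < u s0 x₀ := by
    refine lt_of_le_of_ne (hpos s0 (hsub hs0) x₀ hx₀c) (fun h => ?_)
    have : z ≤ s0 := hzmin (a := s0) ⟨⟨by linarith [hs0.1], by linarith [hs0.2]⟩, h.symm⟩
    linarith [hs0.2]
  have hloc : IsLocalMin (u z) x₀ := by
    filter_upwards [hΩo.mem_nhds hx₀] with y hy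
    rw [hz]; exact hpos z ⟨hz0.le, hzT.2⟩ y (subset_closure hy)
  have e1 := heqT z hzT x₀ hx₀
  have e2 := ellOp_nonneg (bC := bC) hΩo hx₀ hell (hudiff z hzT) hloc
  have e3 := hf0 z ⟨hz0.le, hzT.2⟩ x₀ hx₀c
  have e4 := Dk_bound hk (w := fun t => u t x₀) (w0 := u₀ x₀) (t := z) (a := a) (b := b) (c := u s0 x₀)
    hzT.2 (hu_t x₀ hx₀c) ha hab.le (by linarith [ht.1])
    (fun s hs => by simp only [hz]; exact hpos s ⟨hs.1, hs.2.trans hzT.2⟩ x₀ hx₀c)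
    (fun s hs => by simp only [hz, zero_add]; exact hs0min hs)
    (hDkdiff x₀ hx₀c z hzT) (has4 z hzT x₀ hx₀c)
  simp only [hz] at e1 e4
  have e8 : 0 ≤ k z * u₀ x₀ := mul_nonneg (hk.2.2.1 z hzT).le (hu₀ x₀ hx₀)
  have e9 : 0 < u s0 x₀ * (k a - k b) := mul_pos hcpos (by linarith)
  nlinarith
end

section
/- Let k ∈ L¹(0,T) ∩ C(0,T] be positive and decreasing on (0,T], let v ∈ C([0,T]) and t_1 ∈ (0,T] satisfy v(τ) ≥ v(t_1) for all τ ∈ [0,t_1]. Assume lim_{ε→0⁺} (1/ε) ∫_0^ε k(τ) dτ · sup_{0≤s≤ε}|v(t_1−s) − v(t_1)| = 0, and assume that the function t ↦ ∫_0^t k(t−τ)(v(τ) − v(0)) dτ is differentiable at t = t_1. Then D^{{k}}[v − v(0)](t_1) ≤ k(t_1)·(v(t_1) − v(0)). -/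
open Set MeasureTheory Filter Topology

lemma Dk_aux_diff
    (T : ℝ) (k : ℝ → ℝ) (hk : KernelOK k T)
    (v : ℝ → ℝ) (hv : ContinuousOn v (Icc 0 T))
    (t₁ : ℝ) (ht₁ : t₁ ∈ Ioc (0:ℝ) T)
    (hmin : ∀ τ ∈ Icc (0:ℝ) t₁, v t₁ ≤ v τ) (ε : ℝ) (h0 : 0 < ε) (h1 : ε < t₁) :
    kConv k (fun τ => v τ - v 0) t₁ - kConv k (fun τ => v τ - v 0) (t₁ - ε) ≤
      (∫ τ in (0:ℝ)..ε, k τ) * sSup ((fun s => |v (t₁ - s) - v t₁|) '' Icc 0 ε)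
        + ε * (k t₁ * (v t₁ - v 0)) := by
  obtain ⟨hki, hkc, hkp, hkm⟩ := hk
  obtain ⟨ht0, htT⟩ := ht₁
  have hT : 0 < T := ht0.trans_le htT
  have hkI : IntervalIntegrable k volume 0 T := (intervalIntegrable_iff_integrableOn_Ioc_of_le hT.le).2 hki
  have hkab : ∀ a b, 0 ≤ a → a ≤ b → b ≤ T → IntervalIntegrable k volume a b := by
    intro a b ha hab hb
    apply hkI.mono_set
    rw [uIcc_of_le hab, uIcc_of_le hT.le]
    exact Icc_subset_Icc ha hb
  have hks : ∀ t a b, 0 ≤ t - b → a ≤ b → t - a ≤ T →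
      IntervalIntegrable (fun τ => k (t - τ)) volume a b := by
    intro t a b h h' h''
    have := (hkab (t - b) (t - a) h (by linarith) h'').comp_sub_left t
    simpa using this.symm
  have hkw : ∀ t a b, 0 ≤ a → 0 ≤ t - b → a ≤ b → t ≤ T →
      IntervalIntegrable (fun τ => k (t - τ) * (v τ - v 0)) volume a b := by
    intro t a b ha h h' h''
    apply (hks t a b h h' (by linarith)).mul_continuousOn
    rw [uIcc_of_le h']
    exact (hv.mono (Icc_subset_Icc ha (by linarith))).sub continuousOn_const
  set c := v t₁ - v 0 with hc
  set S := sSup ((fun s => |v (t₁ - s) - v t₁|) '' Icc 0 ε) with hS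
  have hc0 : c ≤ 0 := by
    have := hmin 0 ⟨le_rfl, ht0.le⟩
    linarith
  have hbdd : BddAbove ((fun s => |v (t₁ - s) - v t₁|) '' Icc 0 ε) := by
    apply IsCompact.bddAbove
    apply isCompact_Icc.image_of_continuousOn
    apply ContinuousOn.abs
    apply ContinuousOn.sub _ continuousOn_const
    apply hv.comp (by fun_prop)
    intro s hs
    exact ⟨by linarith [hs.2], by linarith [hs.1]⟩
  have hSle : ∀ τ ∈ Icc (t₁ - ε) t₁, v τ - v t₁ ≤ S := by
    intro τ hτ
    have := le_csSup hbdd ⟨t₁ - τ, ⟨by linarith [hτ.2], by linarith [hτ.1]⟩, rfl⟩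
    simp only [sub_sub_cancel] at this
    exact (le_abs_self _).trans this
  have e1 : kConv k (fun τ => v τ - v 0) t₁ =
      (∫ τ in (0:ℝ)..(t₁ - ε), k (t₁ - τ) * (v τ - v 0))
        + ∫ τ in (t₁ - ε)..t₁, k (t₁ - τ) * (v τ - v 0) := by
    unfold kConv
    rw [intervalIntegral.integral_add_adjacent_intervals]
    · exact hkw _ _ _ le_rfl (by linarith) (by linarith) htT
    · exact hkw _ _ _ (by linarith) (by linarith) (by linarith) htT
  have A : (∫ τ in (0:ℝ)..(t₁ - ε), k (t₁ - τ) * (v τ - v 0))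
      - kConv k (fun τ => v τ - v 0) (t₁ - ε) ≤
      c * ((∫ τ in ε..t₁, k τ) - ∫ τ in (0:ℝ)..(t₁ - ε), k τ) := by
    have i1 := hks t₁ 0 (t₁ - ε) (by linarith) (by linarith) (by linarith)
    have i2 := hks (t₁ - ε) 0 (t₁ - ε) (by linarith) (by linarith) (by linarith)
    have j1 := hkw t₁ 0 (t₁ - ε) le_rfl (by linarith) (by linarith) (by linarith)
    have j2 := hkw (t₁ - ε) 0 (t₁ - ε) le_rfl (by linarith) (by linarith) (by linarith)
    have r : c * ((∫ τ in ε..t₁, k τ) - ∫ τ in (0:ℝ)..(t₁ - ε), k τ) =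
        ∫ τ in (0:ℝ)..(t₁ - ε), c * (k (t₁ - τ) - k (t₁ - ε - τ)) := by
      rw [intervalIntegral.integral_const_mul, intervalIntegral.integral_sub i1 i2,
        intervalIntegral.integral_comp_sub_left (fun x => k x),
        intervalIntegral.integral_comp_sub_left (fun x => k x)]
      simp
    unfold kConv
    rw [r, ← intervalIntegral.integral_sub j1 j2]
    apply intervalIntegral.integral_mono_on_of_le_Ioo (by linarith) (j1.sub j2)
      ((i1.sub i2).const_mul c)
    intro τ hτ
    have m := hkm (t₁ - ε - τ) ⟨by linarith [hτ.2], by linarith [hτ.1]⟩ (t₁ - τ)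
      ⟨by linarith [hτ.2], by linarith [hτ.1]⟩ (by linarith)
    have := hmin τ ⟨hτ.1.le, by linarith [hτ.2]⟩
    nlinarith
  have B : (∫ τ in (t₁ - ε)..t₁, k (t₁ - τ) * (v τ - v 0)) ≤ (∫ τ in (0:ℝ)..ε, k τ) * (c + S) := by
    have i1 := hks t₁ (t₁ - ε) t₁ (by linarith) (by linarith) (by linarith)
    have j1 := hkw t₁ (t₁ - ε) t₁ (by linarith) (by linarith) (by linarith) (by linarith)
    have r : (∫ τ in (0:ℝ)..ε, k τ) * (c + S) = ∫ τ in (t₁ - ε)..t₁, k (t₁ - τ) * (c + S) := by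
      rw [intervalIntegral.integral_mul_const,
        intervalIntegral.integral_comp_sub_left (fun x => k x)]
      simp
    rw [r]
    apply intervalIntegral.integral_mono_on_of_le_Ioo (by linarith) j1 (i1.mul_const _)
    intro τ hτ
    have p := hkp (t₁ - τ) ⟨by linarith [hτ.2], by linarith [hτ.1]⟩
    have := hSle τ ⟨hτ.1.le, hτ.2.le⟩
    apply mul_le_mul_of_nonneg_left _ p.le
    linarith
  have C : ε * k t₁ ≤ ∫ τ in (t₁ - ε)..t₁, k τ := by
    have : ε * k t₁ = ∫ τ in (t₁ - ε)..t₁, k t₁ := by simp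
    rw [this]
    apply intervalIntegral.integral_mono_on_of_le_Ioo (by linarith) (by simp)
      (hkab _ _ (by linarith) (by linarith) htT)
    intro τ hτ
    exact hkm τ ⟨by linarith [hτ.1], by linarith [hτ.2]⟩ t₁ ⟨ht0, htT⟩ hτ.2.le
  have a1 := intervalIntegral.integral_add_adjacent_intervals
    (hkab 0 ε le_rfl h0.le (by linarith)) (hkab ε t₁ h0.le h1.le htT)
  have a2 := intervalIntegral.integral_add_adjacent_intervals
    (hkab 0 (t₁ - ε) le_rfl (by linarith) (by linarith))
    (hkab (t₁ - ε) t₁ (by linarith) (by linarith) htT)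
  have D := mul_le_mul_of_nonpos_left C hc0
  have E : (∫ τ in ε..t₁, k τ) = (∫ τ in (0:ℝ)..(t₁ - ε), k τ) + (∫ τ in (t₁ - ε)..t₁, k τ)
    - ∫ τ in (0:ℝ)..ε, k τ := by linarith
  rw [E] at A
  rw [e1]
  linarith

/-- If `(t₁,x₁)` realizes the minimum of `v` on `[0,t₁]` then the generalized fractional
derivative of `v - v(0)` at `t₁` is at most `k(t₁)(v(t₁) - v(0))`. -/
theorem Dk_at_min_le
    (T : ℝ) (hT : 0 < T) (k : ℝ → ℝ) (hk : KernelOK k T)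
    (v : ℝ → ℝ) (hv : ContinuousOn v (Icc 0 T))
    (t₁ : ℝ) (ht₁ : t₁ ∈ Ioc (0:ℝ) T)
    (hmin : ∀ τ ∈ Icc (0:ℝ) t₁, v t₁ ≤ v τ)
    (hlim : Tendsto (fun ε => ε⁻¹ * (∫ τ in (0:ℝ)..ε, k τ) *
        sSup ((fun s => |v (t₁ - s) - v t₁|) '' Icc 0 ε)) (𝓝[>] 0) (𝓝 0))
    (hdiff : DifferentiableWithinAt ℝ (kConv k (fun τ => v τ - v 0)) (Icc 0 T) t₁) :
    Dk k T (fun τ => v τ - v 0) t₁ ≤ k t₁ * (v t₁ - v 0) := by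
  have hF := hdiff.hasDerivWithinAt
  obtain ⟨ht0, htT⟩ := ht₁
  unfold Dk
  set F := kConv k (fun τ => v τ - v 0) with hFdef
  have hL : HasDerivWithinAt F (derivWithin F (Icc 0 T) t₁) (Ioo 0 t₁) t₁ :=
    hF.mono (fun x hx => ⟨hx.1.le, hx.2.le.trans htT⟩)
  rw [hasDerivWithinAt_iff_tendsto_slope' (by simp)] at hL
  have hg : Tendsto (fun ε : ℝ => t₁ - ε) (𝓝[>] 0) (𝓝[Ioo 0 t₁] t₁) := by
    apply tendsto_nhdsWithin_iff.2 ⟨_, _⟩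
    · apply tendsto_nhdsWithin_of_tendsto_nhds
      have : Continuous (fun ε : ℝ => t₁ - ε) := by fun_prop
      simpa using this.tendsto 0
    · filter_upwards [Ioo_mem_nhdsGT ht0] with ε hε
      exact ⟨by linarith [hε.2], by linarith [hε.1]⟩
  have h2 := hlim.add_const (k t₁ * (v t₁ - v 0))
  rw [zero_add] at h2
  refine le_of_tendsto_of_tendsto (hL.comp hg) h2 ?_
  filter_upwards [Ioo_mem_nhdsGT ht0] with ε hε
  have key := Dk_aux_diff T k hk v hv t₁ ⟨ht0, htT⟩ hmin ε hε.1 hε.2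
  have h0 := hε.1
  have e : slope F t₁ (t₁ - ε) = ε⁻¹ * (F t₁ - F (t₁ - ε)) := by
    rw [slope_def_field, show t₁ - ε - t₁ = -ε by ring]
    field_simp
    ring
  simp only [Function.comp]
  rw [e]
  have := mul_le_mul_of_nonneg_left key (inv_pos.2 h0).le
  refine this.trans (le_of_eq ?_)
  field_simp
end

section
/- Let k ∈ L¹(0,T) ∩ C(0,T] be positive and decreasing on (0,T], let v ∈ C([0,T]) with v ≥ 0 on [0,t_0], v(t_0) = 0 for some t_0 ∈ (0,T], and suppose there are δ > 0 and 0 < t_2 < t_3 < t_0 such that v(t) ≥ δ for t ∈ (t_2,t_3). Let c ≥ 0 be a constant. Assume lim_{ε→0⁺} (1/ε) ∫_0^ε k(τ) dτ · sup_{0≤s≤ε}|v(t_0−s) − v(t_0)| = 0 and that t ↦ ∫_0^t k(t−τ)(v(τ) − c) dτ is differentiable at t = t_0. Then D^{{k}}[v − c](t_0) ≤ δ·[k(t_0−t_2) − k(t_0−t_3)]; in particular, if k is strictly decreasing, then D^{{k}}[v − c](t_0) < 0. -/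
open Set MeasureTheory Filter Topology

theorem aux_bound
    (T : ℝ) (k : ℝ → ℝ) (hk : KernelOK k T)
    (v : ℝ → ℝ) (hv : ContinuousOn v (Icc 0 T))
    (t₀ : ℝ) (ht₀ : t₀ ∈ Ioc (0:ℝ) T)
    (hnn : ∀ τ ∈ Icc (0:ℝ) t₀, 0 ≤ v τ) (hv0 : v t₀ = 0)
    (δ t₂ t₃ : ℝ) (hδ : 0 < δ) (ht₂ : 0 < t₂) (ht₂₃ : t₂ < t₃) (ht₃ : t₃ < t₀)
    (hlow : ∀ t ∈ Ioo t₂ t₃, δ ≤ v t)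
    (c : ℝ) (hc : 0 ≤ c) (ε : ℝ) (hε : 0 < ε) (hε' : ε < t₀ - t₃) :
    kConv k (fun τ => v τ - c) t₀ - kConv k (fun τ => v τ - c) (t₀ - ε) ≤
      (∫ τ in (0:ℝ)..ε, k τ) * sSup ((fun s => |v (t₀ - s) - v t₀|) '' Icc 0 ε)
      + ε * (δ * (k (t₀ - t₂ - ε) - k (t₀ - t₃))) := by
  obtain ⟨hint, hcont, hpos, hanti⟩ := hk
  obtain ⟨h0, hT⟩ := ht₀
  have kint : ∀ a b, 0 ≤ a → a ≤ T → 0 ≤ b → b ≤ T → IntervalIntegrable k volume a b := by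
    intro a b ha haT hb hbT
    rw [intervalIntegrable_iff]
    refine hint.mono_set ?_
    intro x hx
    rw [uIoc, mem_Ioc] at hx
    exact ⟨lt_of_le_of_lt (le_min ha hb) hx.1, hx.2.trans (max_le haT hbT)⟩
  have ksh : ∀ t a b, t ≤ T → 0 ≤ a → a ≤ t → 0 ≤ b → b ≤ t →
      IntervalIntegrable (fun τ => k (t - τ)) volume a b := by
    intro t a b htT ha hat hb hbt
    have := (kint (t - a) (t - b) (by linarith) (by linarith) (by linarith)
      (by linarith)).comp_sub_left t
    simpa using this
  have vsh : ∀ t a b, t ≤ T → 0 ≤ a → a ≤ t → 0 ≤ b → b ≤ t →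
      IntervalIntegrable (fun τ => k (t - τ) * v τ) volume a b := by
    intro t a b htT ha hat hb hbt
    refine (ksh t a b htT ha hat hb hbt).mul_continuousOn (hv.mono ?_)
    intro x hx
    rw [uIcc, mem_Icc] at hx
    exact ⟨(le_min ha hb).trans hx.1, hx.2.trans (max_le (hat.trans htT) (hbt.trans htT))⟩
  have conv : ∀ t, 0 ≤ t → t ≤ T → kConv k (fun τ => v τ - c) t =
      (∫ τ in (0:ℝ)..t, k (t - τ) * v τ) - c * ∫ τ in (0:ℝ)..t, k τ := by
    intro t ht htT
    unfold kConv
    have e : ∀ τ, k (t - τ) * (v τ - c) = k (t - τ) * v τ - c * k (t - τ) := by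
      intro τ; ring
    simp_rw [e]
    rw [intervalIntegral.integral_sub (vsh t 0 t htT le_rfl ht ht le_rfl)
      ((ksh t 0 t htT le_rfl ht ht le_rfl).const_mul c), intervalIntegral.integral_const_mul,
      intervalIntegral.integral_comp_sub_left]
    simp
  rw [conv t₀ h0.le hT, conv (t₀ - ε) (by linarith) (by linarith)]
  -- splitting
  have s1 : (∫ τ in (0:ℝ)..t₀, k (t₀ - τ) * v τ) = (∫ τ in (0:ℝ)..(t₀ - ε), k (t₀ - τ) * v τ)
      + ∫ τ in (t₀ - ε)..t₀, k (t₀ - τ) * v τ :=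
    (intervalIntegral.integral_add_adjacent_intervals
      (vsh _ _ _ hT le_rfl h0.le (by linarith) (by linarith))
      (vsh _ _ _ hT (by linarith) (by linarith) h0.le le_rfl)).symm
  have s2 : (∫ τ in (0:ℝ)..(t₀ - ε), k τ) ≤ ∫ τ in (0:ℝ)..t₀, k τ := by
    rw [← intervalIntegral.integral_add_adjacent_intervals
      (kint 0 (t₀ - ε) le_rfl (by linarith) (by linarith) (by linarith))
      (kint (t₀ - ε) t₀ (by linarith) (by linarith) (by linarith) (by linarith))]
    have : 0 ≤ ∫ τ in (t₀ - ε)..t₀, k τ := by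
      refine intervalIntegral.integral_nonneg (by linarith) ?_
      intro u hu
      exact (hpos u ⟨by linarith [hu.1], by linarith [hu.2]⟩).le
    linarith
  have s3 := mul_le_mul_of_nonneg_left s2 hc
  -- second term
  set S := sSup ((fun s => |v (t₀ - s) - v t₀|) '' Icc 0 ε) with hS
  have hbdd : BddAbove ((fun s => |v (t₀ - s) - v t₀|) '' Icc 0 ε) := by
    refine (isCompact_Icc.image_of_continuousOn ?_).bddAbove
    refine ContinuousOn.abs (ContinuousOn.sub ?_ continuousOn_const)
    refine hv.comp (by fun_prop) ?_
    intro s hs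
    exact ⟨by linarith [hs.2], by linarith [hs.1]⟩
  have s4 : (∫ τ in (t₀ - ε)..t₀, k (t₀ - τ) * v τ) ≤ (∫ τ in (0:ℝ)..ε, k τ) * S := by
    have e : (∫ τ in (0:ℝ)..ε, k τ) * S = ∫ τ in (t₀ - ε)..t₀, k (t₀ - τ) * S := by
      rw [intervalIntegral.integral_mul_const, intervalIntegral.integral_comp_sub_left]
      simp
    rw [e]
    refine intervalIntegral.integral_mono_on_of_le_Ioo (by linarith)
      (vsh _ _ _ hT (by linarith) (by linarith) h0.le le_rfl)
      ((ksh _ _ _ hT (by linarith) (by linarith) h0.le le_rfl).mul_const S) ?_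
    intro x hx
    refine mul_le_mul_of_nonneg_left ?_
      (hpos _ ⟨by linarith [hx.2], by linarith [hx.1]⟩).le
    have : |v (t₀ - (t₀ - x)) - v t₀| ≤ S :=
      le_csSup hbdd ⟨t₀ - x, ⟨by linarith [hx.2], by linarith [hx.1]⟩, rfl⟩
    rw [hv0, sub_sub_cancel, sub_zero] at this
    exact (le_abs_self _).trans this
  -- first term
  have hh : ∀ a b, 0 ≤ a → a ≤ t₀ - ε → 0 ≤ b → b ≤ t₀ - ε →
      IntervalIntegrable (fun τ => k (t₀ - τ) * v τ - k (t₀ - ε - τ) * v τ) volume a b := by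
    intro a b ha ha' hb hb'
    exact (vsh _ _ _ hT ha (by linarith) hb (by linarith)).sub
      (vsh _ _ _ (by linarith) ha ha' hb hb')
  have kle : ∀ τ, 0 ≤ τ → τ < t₀ - ε → k (t₀ - τ) ≤ k (t₀ - ε - τ) := by
    intro τ h1 h2
    exact hanti _ ⟨by linarith, by linarith⟩ _ ⟨by linarith, by linarith⟩ (by linarith)
  have hnp : ∀ a b, 0 ≤ a → a ≤ b → b ≤ t₀ - ε →
      (∫ τ in a..b, (k (t₀ - τ) * v τ - k (t₀ - ε - τ) * v τ)) ≤ 0 := by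
    intro a b ha hab hb
    have : (∫ τ in a..b, (k (t₀ - τ) * v τ - k (t₀ - ε - τ) * v τ)) ≤ ∫ τ in a..b, (0:ℝ) := by
      refine intervalIntegral.integral_mono_on_of_le_Ioo hab
        (hh a b ha (by linarith) (by linarith) hb) (by simp) ?_
      intro x hx
      have h1 := kle x (by linarith [hx.1]) (by linarith [hx.2])
      have h2 := hnn x ⟨by linarith [hx.1], by linarith [hx.2]⟩
      nlinarith
    simpa using this
  have s5 : (∫ τ in (0:ℝ)..(t₀ - ε), k (t₀ - τ) * v τ)
      - (∫ τ in (0:ℝ)..(t₀ - ε), k (t₀ - ε - τ) * v τ)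
      ≤ ∫ τ in t₂..t₃, (k (t₀ - τ) * v τ - k (t₀ - ε - τ) * v τ) := by
    rw [← intervalIntegral.integral_sub (vsh _ _ _ hT le_rfl (by linarith) (by linarith)
      (by linarith)) (vsh _ _ _ (by linarith) le_rfl (by linarith) (by linarith) le_rfl),
      ← intervalIntegral.integral_add_adjacent_intervals
        (hh 0 t₃ le_rfl (by linarith) (by linarith) (by linarith))
        (hh t₃ (t₀ - ε) (by linarith) (by linarith) (by linarith) le_rfl),
      ← intervalIntegral.integral_add_adjacent_intervals
        (hh 0 t₂ le_rfl (by linarith) (by linarith) (by linarith))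
        (hh t₂ t₃ (by linarith) (by linarith) (by linarith) (by linarith))]
    have h1 := hnp 0 t₂ le_rfl ht₂.le (by linarith)
    have h2 := hnp t₃ (t₀ - ε) (by linarith) (by linarith) le_rfl
    linarith
  have i1 := ksh t₀ t₂ t₃ hT (by linarith) (by linarith) (by linarith) (by linarith)
  have i2 := ksh (t₀ - ε) t₂ t₃ (by linarith) (by linarith) (by linarith) (by linarith)
    (by linarith)
  have s6 : (∫ τ in t₂..t₃, (k (t₀ - τ) * v τ - k (t₀ - ε - τ) * v τ)) ≤
      ∫ τ in t₂..t₃, δ * (k (t₀ - τ) - k (t₀ - ε - τ)) := by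
    refine intervalIntegral.integral_mono_on_of_le_Ioo ht₂₃.le
      (hh _ _ (by linarith) (by linarith) (by linarith) (by linarith))
      ((i1.sub i2).const_mul δ) ?_
    intro x hx
    have h1 := kle x (by linarith [hx.1]) (by linarith [hx.2])
    have h2 := hlow x hx
    nlinarith
  have s7 : (∫ τ in t₂..t₃, δ * (k (t₀ - τ) - k (t₀ - ε - τ))) =
      δ * ((∫ τ in (t₀ - t₂ - ε)..(t₀ - t₂), k τ) - ∫ τ in (t₀ - t₃ - ε)..(t₀ - t₃), k τ) := by
    rw [intervalIntegral.integral_const_mul, intervalIntegral.integral_sub i1 i2,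
      intervalIntegral.integral_comp_sub_left, intervalIntegral.integral_comp_sub_left]
    have e1 := intervalIntegral.integral_add_adjacent_intervals
      (kint (t₀ - t₃ - ε) (t₀ - t₃) (by linarith) (by linarith) (by linarith) (by linarith))
      (kint (t₀ - t₃) (t₀ - t₂) (by linarith) (by linarith) (by linarith) (by linarith))
    have e2 := intervalIntegral.integral_add_adjacent_intervals
      (kint (t₀ - t₃ - ε) (t₀ - t₂ - ε) (by linarith) (by linarith) (by linarith) (by linarith))
      (kint (t₀ - t₂ - ε) (t₀ - t₂) (by linarith) (by linarith) (by linarith) (by linarith))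
    rw [sub_right_comm t₀ ε t₃, sub_right_comm t₀ ε t₂]
    congr 1
    linarith
  have s8 : (∫ τ in (t₀ - t₂ - ε)..(t₀ - t₂), k τ) ≤ ε * k (t₀ - t₂ - ε) := by
    have : (∫ τ in (t₀ - t₂ - ε)..(t₀ - t₂), k τ) ≤
        ∫ τ in (t₀ - t₂ - ε)..(t₀ - t₂), k (t₀ - t₂ - ε) := by
      refine intervalIntegral.integral_mono_on (by linarith)
        (kint _ _ (by linarith) (by linarith) (by linarith) (by linarith)) (by simp) ?_
      intro x hx
      exact hanti _ ⟨by linarith, by linarith⟩ _ ⟨by linarith [hx.1], by linarith [hx.2]⟩ hx.1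
    simpa using this
  have s9 : ε * k (t₀ - t₃) ≤ (∫ τ in (t₀ - t₃ - ε)..(t₀ - t₃), k τ) := by
    have : (∫ τ in (t₀ - t₃ - ε)..(t₀ - t₃), k (t₀ - t₃)) ≤
        ∫ τ in (t₀ - t₃ - ε)..(t₀ - t₃), k τ := by
      refine intervalIntegral.integral_mono_on (by linarith) (by simp)
        (kint _ _ (by linarith) (by linarith) (by linarith) (by linarith)) ?_
      intro x hx
      exact hanti _ ⟨by linarith [hx.1], by linarith [hx.2]⟩ _ ⟨by linarith, by linarith⟩ hx.2
    simpa using this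
  have s10 := mul_le_mul_of_nonneg_left (sub_le_sub s8 s9) hδ.le
  rw [s1]
  linarith

/-- If `v ≥ 0` on `[0,t₀]`, `v(t₀) = 0`, and `v ≥ δ` on some earlier interval `(t₂,t₃)`, then
`D^{{k}}[v - c](t₀) ≤ δ (k(t₀-t₂) - k(t₀-t₃))`; in particular `D^{{k}}[v - c](t₀) < 0`
whenever `k` is strictly decreasing. -/
theorem Dk_at_zero_neg
    (T : ℝ) (hT : 0 < T) (k : ℝ → ℝ) (hk : KernelOK k T)
    (v : ℝ → ℝ) (hv : ContinuousOn v (Icc 0 T))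
    (t₀ : ℝ) (ht₀ : t₀ ∈ Ioc (0:ℝ) T)
    (hnn : ∀ τ ∈ Icc (0:ℝ) t₀, 0 ≤ v τ) (hv0 : v t₀ = 0)
    (δ t₂ t₃ : ℝ) (hδ : 0 < δ) (ht₂ : 0 < t₂) (ht₂₃ : t₂ < t₃) (ht₃ : t₃ < t₀)
    (hlow : ∀ t ∈ Ioo t₂ t₃, δ ≤ v t)
    (c : ℝ) (hc : 0 ≤ c)
    (hlim : Tendsto (fun ε => ε⁻¹ * (∫ τ in (0:ℝ)..ε, k τ) *
        sSup ((fun s => |v (t₀ - s) - v t₀|) '' Icc 0 ε)) (𝓝[>] 0) (𝓝 0))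
    (hdiff : DifferentiableWithinAt ℝ (kConv k (fun τ => v τ - c)) (Icc 0 T) t₀) :
    Dk k T (fun τ => v τ - c) t₀ ≤ δ * (k (t₀ - t₂) - k (t₀ - t₃)) ∧
    ((∀ s ∈ Ioc (0:ℝ) T, ∀ t ∈ Ioc (0:ℝ) T, s < t → k t < k s) →
      Dk k T (fun τ => v τ - c) t₀ < 0) := by
  have main : Dk k T (fun τ => v τ - c) t₀ ≤ δ * (k (t₀ - t₂) - k (t₀ - t₃)) := by
    have hd := hdiff.hasDerivWithinAt
    rw [hasDerivWithinAt_iff_tendsto_slope] at hd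
    have hsub : Tendsto (fun ε : ℝ => t₀ - ε) (𝓝[>] 0) (𝓝[Icc 0 T \ {t₀}] t₀) := by
      refine tendsto_nhdsWithin_iff.2 ⟨?_, ?_⟩
      · have : Tendsto (fun ε : ℝ => t₀ - ε) (𝓝 0) (𝓝 (t₀ - 0)) :=
          Continuous.tendsto (by fun_prop) 0
        rw [sub_zero] at this
        exact this.mono_left nhdsWithin_le_nhds
      · filter_upwards [Ioo_mem_nhdsGT ht₀.1] with ε hε
        refine ⟨⟨by linarith [hε.2], by linarith [hε.1, ht₀.2]⟩, ?_⟩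
        have := hε.1
        simp only [mem_singleton_iff]
        intro h
        linarith
    have hl := hd.comp hsub
    have hkc : Tendsto (fun ε : ℝ => k (t₀ - t₂ - ε)) (𝓝[>] 0) (𝓝 (k (t₀ - t₂))) := by
      have h1 : ContinuousAt k (t₀ - t₂) :=
        hk.2.1.continuousAt (Ioc_mem_nhds (by linarith) (by linarith [ht₀.2]))
      refine h1.tendsto.comp ?_
      have : Tendsto (fun ε : ℝ => t₀ - t₂ - ε) (𝓝 0) (𝓝 (t₀ - t₂ - 0)) :=
        Continuous.tendsto (by fun_prop) 0
      rw [sub_zero] at this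
      exact this.mono_left nhdsWithin_le_nhds
    have hr := hlim.add ((hkc.sub_const (k (t₀ - t₃))).const_mul δ)
    rw [zero_add] at hr
    refine le_of_tendsto_of_tendsto hl hr ?_
    filter_upwards [Ioo_mem_nhdsGT (show (0:ℝ) < t₀ - t₃ by linarith)] with ε hε
    have hb := aux_bound T k hk v hv t₀ ht₀ hnn hv0 δ t₂ t₃ hδ ht₂ ht₂₃ ht₃ hlow c hc ε
      hε.1 hε.2
    have hb2 := mul_le_mul_of_nonneg_left hb (inv_nonneg.2 hε.1.le)
    rw [mul_add, inv_mul_cancel_left₀ hε.1.ne', ← mul_assoc] at hb2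
    refine le_trans (le_of_eq ?_) hb2
    simp only [Function.comp, slope_def_field]
    rw [sub_sub_cancel_left, div_neg, ← neg_div, neg_sub, div_eq_inv_mul]
  refine ⟨main, fun hs => lt_of_le_of_lt main ?_⟩
  have := hs (t₀ - t₃) ⟨by linarith, by linarith [ht₀.2]⟩ (t₀ - t₂)
    ⟨by linarith, by linarith [ht₀.2]⟩ (by linarith)
  exact mul_neg_of_pos_of_neg hδ (by linarith)
end

section
/- Let k ∈ L¹(0,T) ∩ C(0,T] be positive and decreasing on (0,T], and let σ > 0. Define k̃(t) = e^{−σt} k(t) + σ ∫_T^t e^{−σs} k(s) ds for t ∈ (0,T]. Then k̃ ∈ L¹(0,T) ∩ C(0,T], k̃ > 0 on (0,T], and k̃ is decreasing on (0,T]. -/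
open Set MeasureTheory Filter Topology

/-- The transformed kernel `k̃(t) = e^{-σt} k(t) + σ ∫_T^t e^{-σs} k(s) ds` is again in
`L¹(0,T) ∩ C(0,T]`, positive and decreasing. -/
theorem kernel_transform_ok
    (T σ : ℝ) (hT : 0 < T) (hσ : 0 < σ) (k : ℝ → ℝ) (hk : KernelOK k T)
    (ktil : ℝ → ℝ)
    (hdef : ∀ t ∈ Ioc (0:ℝ) T,
      ktil t = Real.exp (-σ * t) * k t + σ * ∫ s in T..t, Real.exp (-σ * s) * k s) :
    KernelOK ktil T := by
  obtain ⟨hi, hc, hp, hd⟩ := hk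
  set g : ℝ → ℝ := fun s => Real.exp (-σ * s) * k s with hg
  have hec : Continuous (fun s : ℝ => Real.exp (-σ * s)) := by fun_prop
  have hgi : IntegrableOn g (Ioc 0 T) := by
    refine Integrable.bdd_mul (c := 1) hi hec.aestronglyMeasurable ?_
    filter_upwards [ae_restrict_mem measurableSet_Ioc] with x hx
    rw [Real.norm_eq_abs, abs_of_pos (Real.exp_pos _), Real.exp_le_one_iff]
    nlinarith [hx.1]
  have hgI : IntervalIntegrable g volume 0 T :=
    (intervalIntegrable_iff_integrableOn_Ioc_of_le hT.le).2 hgi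
  have hsub : ∀ a ∈ Icc (0:ℝ) T, ∀ b ∈ Icc (0:ℝ) T, IntervalIntegrable g volume a b := by
    intro a ha b hb
    refine hgI.mono_set ?_
    rw [uIcc_of_le hT.le]
    exact uIcc_subset_Icc ha hb
  have hprim : ContinuousOn (fun t => ∫ s in T..t, g s) (Icc 0 T) := by
    have := intervalIntegral.continuousOn_primitive_interval' (a := T) hgI right_mem_uIcc
    rwa [uIcc_of_le hT.le] at this
  have hmono : ∀ s ∈ Ioc (0:ℝ) T, ∀ t ∈ Ioc (0:ℝ) T, s ≤ t → ktil t ≤ ktil s := by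
    intro s hs t ht hst
    rw [hdef s hs, hdef t ht]
    have hT' : T ∈ Icc (0:ℝ) T := ⟨hT.le, le_rfl⟩
    have hs' : s ∈ Icc (0:ℝ) T := Ioc_subset_Icc_self hs
    have ht' : t ∈ Icc (0:ℝ) T := Ioc_subset_Icc_self ht
    have hadd := intervalIntegral.integral_add_adjacent_intervals (hsub T hT' s hs') (hsub s hs' t ht')
    have hle : ∫ r in s..t, g r ≤ ∫ r in s..t, Real.exp (-σ * r) * k s := by
      refine intervalIntegral.integral_mono_on hst (hsub s hs' t ht')
        ((by fun_prop : Continuous fun r : ℝ => Real.exp (-σ * r) * k s).intervalIntegrable _ _) ?_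
      intro r hr
      exact mul_le_mul_of_nonneg_left
        (hd s hs r ⟨hs.1.trans_le hr.1, hr.2.trans ht.2⟩ hr.1) (Real.exp_pos _).le
    have hint : σ * ∫ r in s..t, Real.exp (-σ * r) * k s
        = (Real.exp (-σ * s) - Real.exp (-σ * t)) * k s := by
      have hder : ∀ r ∈ uIcc s t, HasDerivAt (fun r : ℝ => -(Real.exp (-σ * r) * k s))
          (σ * (Real.exp (-σ * r) * k s)) r := by
        intro r _
        have h1 : HasDerivAt (fun r : ℝ => -σ * r) (-σ) r := by
          simpa using (hasDerivAt_id r).const_mul (-σ)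
        exact (h1.exp.mul_const (k s)).neg.congr_deriv (by ring)
      rw [← intervalIntegral.integral_const_mul,
        intervalIntegral.integral_eq_sub_of_hasDerivAt hder
          ((by fun_prop : Continuous fun r : ℝ =>
            σ * (Real.exp (-σ * r) * k s)).intervalIntegrable _ _)]
      ring
    have h2 := mul_le_mul_of_nonneg_left hle hσ.le
    rw [hint] at h2
    have h3 := mul_le_mul_of_nonneg_left (hd s hs t ht hst) (Real.exp_pos (-σ * t)).le
    rw [← hadd]
    linarith
  refine ⟨?_, ?_, ?_, hmono⟩
  · have h1 : IntegrableOn (fun t => g t + σ * ∫ s in T..t, g s) (Ioc 0 T) :=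
      hgi.add (((hprim.integrableOn_Icc).mono_set Ioc_subset_Icc_self).const_mul σ)
    exact h1.congr_fun (fun t ht => (hdef t ht).symm) measurableSet_Ioc
  · have h1 : ContinuousOn (fun t => g t + σ * ∫ s in T..t, g s) (Ioc 0 T) :=
      (hec.continuousOn.mul hc).add
        (continuousOn_const.mul (hprim.mono Ioc_subset_Icc_self))
    exact h1.congr (fun t ht => hdef t ht)
  · intro t ht
    have hT' : T ∈ Ioc (0:ℝ) T := ⟨hT, le_rfl⟩
    refine lt_of_lt_of_le ?_ (hmono t ht T hT' ht.2)
    rw [hdef T hT', intervalIntegral.integral_same, mul_zero, add_zero]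
    exact mul_pos (Real.exp_pos _) (hp T hT')
end
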